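/- arXiv:math/0603272 — 3 statements merged into one kernel-verified Lean document; each statement's English description precedes it below -/
import Mathlib

section
/- Let n ≥ 1 and let q ∈ ℂ be nonzero and not a root of unity. Let S be the polynomial ring over ℂ in the 2n² variables x_{ij}, y_{ij} (1 ≤ i, j ≤ n), let X and Y be the n×n matrices over S with entries x_{ij} and y_{ij} respectively, and let I ⊆ S be the ideal generated by the n² entries of the matrix X·Y − q·Y·X. Then the Krull dimension of the quotient ring S/I equals n². -/
open MvPolynomial

/-- The generic `n × n` matrix `X` (first copy of variables). -/
noncomputable def genX (n : ℕ) :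
    Matrix (Fin n) (Fin n) (MvPolynomial ((Fin n × Fin n) ⊕ (Fin n × Fin n)) ℂ) :=
  Matrix.of fun i j => MvPolynomial.X (Sum.inl (i, j))

/-- The generic `n × n` matrix `Y` (second copy of variables). -/
noncomputable def genY (n : ℕ) :
    Matrix (Fin n) (Fin n) (MvPolynomial ((Fin n × Fin n) ⊕ (Fin n × Fin n)) ℂ) :=
  Matrix.of fun i j => MvPolynomial.X (Sum.inr (i, j))

lemma trdeg_bound (K : Type) [Field K] [Algebra ℂ K] (s : Finset K) (d : ℕ)
    (f : MvPolynomial (Fin d) ℂ →ₐ[ℂ] K) (hf : Function.Injective f)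
    (h : ∀ a, f a ∈ IntermediateField.adjoin ℂ (s : Set K)) : d ≤ s.card := by
  let F := IntermediateField.adjoin ℂ (s : Set K)
  let f' : MvPolynomial (Fin d) ℂ →ₐ[ℂ] F := f.codRestrict F.toSubalgebra h
  have hf' : Function.Injective f' := by
    intro a b hab
    exact hf (congrArg Subtype.val hab)
  have h1 := trdeg_le_of_injective f' hf'
  rw [MvPolynomial.trdeg_of_isDomain] at h1
  let s' : Set F := Subtype.val ⁻¹' (s : Set K)
  have h3 : (Algebra.adjoin ℂ s').map (F.val) = Algebra.adjoin ℂ (s : Set K) := by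
    rw [AlgHom.map_adjoin]
    congr 1
    ext x
    constructor
    · rintro ⟨y, hy, rfl⟩; exact hy
    · intro hx
      exact ⟨⟨x, IntermediateField.subset_adjoin _ _ hx⟩, hx, rfl⟩
  have key : ∀ y ∈ Algebra.adjoin ℂ (s : Set K), ∃ z : Algebra.adjoin ℂ s', (z : F).val = y := by
    intro y hy
    rw [← h3] at hy
    obtain ⟨z, hz, rfl⟩ := hy
    exact ⟨⟨z, hz⟩, rfl⟩
  have h2 : Algebra.IsAlgebraic (Algebra.adjoin ℂ s') F := by
    constructor
    rintro ⟨x, hx⟩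
    obtain ⟨r, hr, t, ht, hx'⟩ := (IntermediateField.mem_adjoin_iff_div (F := ℂ) (S := (s : Set K))).1 hx
    obtain ⟨r, rfl⟩ := key r hr
    obtain ⟨t, rfl⟩ := key t ht
    have hxx : (⟨x, hx⟩ : F) = (r : F) / (t : F) := Subtype.ext hx'
    rw [hxx, div_eq_mul_inv]
    exact (isAlgebraic_algebraMap r).mul (IsAlgebraic.inv (isAlgebraic_algebraMap t))
  have h4 := Algebra.IsAlgebraic.trdeg_le_cardinalMk ℂ s'
  have h5 : Cardinal.mk s' ≤ s.card := by
    have : Cardinal.mk s' ≤ Cardinal.mk (s : Set K) :=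
      Cardinal.mk_le_of_injective (f := fun x : s' => (⟨x.1.1, x.2⟩ : (s : Set K))) (by
        intro a b hab
        simp only [Subtype.mk.injEq] at hab
        exact Subtype.ext (Subtype.ext hab))
    simpa using this
  have := (h1.trans h4).trans h5
  simpa using this

lemma krull_le (R : Type) [CommRing R] [Nontrivial R] [Algebra ℂ R] [Algebra.FiniteType ℂ R] (N : ℕ)
    (H : ∀ (K : Type) [Field K] [Algebra ℂ K] (φ : R →ₐ[ℂ] K), ∃ s : Finset K, s.card ≤ N ∧
      ∀ r, φ r ∈ IntermediateField.adjoin ℂ (s : Set K)) : ringKrullDim R ≤ N := by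
  obtain ⟨d, g, hinj, hintegral⟩ := exists_integral_inj_algHom_of_fg ℂ R
  have hd : ringKrullDim R ≤ d := by
    algebraize [g.toRingHom]
    have : ringKrullDim R ≤ ringKrullDim (MvPolynomial (Fin d) ℂ) := by
      refine Order.krullDim_le_of_strictMono (PrimeSpectrum.comap (algebraMap (MvPolynomial (Fin d) ℂ) R)) ?_
      intro a b hab
      exact Ideal.IsIntegral.comap_lt_comap (R := MvPolynomial (Fin d) ℂ) hab
    refine this.trans ?_
    rw [MvPolynomial.ringKrullDim_of_isNoetherianRing]
    simp
  refine hd.trans ?_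
  norm_cast
  obtain ⟨Q, hQ, hQ'⟩ : ∃ Q : Ideal R, Q.IsPrime ∧ Q.comap g.toRingHom = ⊥ := by
    algebraize [g.toRingHom]
    obtain ⟨Q, -, hQ, hQ'⟩ := Ideal.exists_ideal_over_prime_of_isIntegral
      (⊥ : Ideal (MvPolynomial (Fin d) ℂ)) (⊥ : Ideal R) (by
        intro x hx
        have : g x = 0 := hx
        exact hinj (by rw [this, map_zero]))
    exact ⟨Q, hQ, hQ'⟩
  let φ : R →ₐ[ℂ] FractionRing (R ⧸ Q) := (IsScalarTower.toAlgHom ℂ (R ⧸ Q) _).comp (Ideal.Quotient.mkₐ ℂ Q)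
  obtain ⟨s, hs, h⟩ := H _ φ
  refine (trdeg_bound _ s d (φ.comp g) ?_ (fun a => h _)).trans hs
  rw [injective_iff_map_eq_zero]
  intro a ha
  have h1 : Ideal.Quotient.mk Q (g a) = 0 :=
    IsFractionRing.injective (R ⧸ Q) (FractionRing (R ⧸ Q)) (by rw [map_zero]; exact ha)
  rw [Ideal.Quotient.eq_zero_iff_mem] at h1
  have : a ∈ Q.comap g.toRingHom := h1
  rw [hQ'] at this
  exact this

lemma coord_proj {K ι : Type} [Field K] [Fintype ι] [DecidableEq ι] (U : Submodule K (ι → K)) :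
    ∃ t : Finset ι, t.card + Module.finrank K U = Fintype.card ι ∧
      ∃ L : (ι → K) →ₗ[K] (ι → K), (∀ v, L v ∈ U) ∧ (∀ v ∈ U, L v = v) ∧
        ∀ v, ∀ j ∉ t, L v j = v j := by
  classical
  let f : ι → (ι → K) ⧸ U := fun j => U.mkQ (Pi.single j 1)
  obtain ⟨κ, a, ha, hspan, hli⟩ := exists_linearIndependent' K f
  have hf : Submodule.span K (Set.range f) = ⊤ := by
    have : Set.range f = U.mkQ '' Set.range (fun j => (Pi.single j 1 : ι → K)) := by
      rw [← Set.range_comp]; rfl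
    rw [this, ← Submodule.map_span]
    have h2 : Submodule.span K (Set.range (fun j => (Pi.single j 1 : ι → K))) = ⊤ := by
      have := (Pi.basisFun K ι).span_eq
      convert this using 3
      funext j
      simp
    rw [h2, Submodule.map_top, Submodule.range_mkQ]
  rw [hf] at hspan
  let b : Module.Basis κ K ((ι → K) ⧸ U) := Module.Basis.mk hli hspan.ge
  have : Finite κ := Finite.of_injective a ha
  have : Fintype κ := Fintype.ofFinite κ
  let σ : ((ι → K) ⧸ U) →ₗ[K] (ι → K) := b.constr K (fun k => Pi.single (a k) 1)
  have hσ : U.mkQ ∘ₗ σ = LinearMap.id := by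
    apply b.ext
    intro k
    simp only [LinearMap.comp_apply, σ, Module.Basis.constr_basis, LinearMap.id_apply]
    simp [b, f]
  refine ⟨Finset.univ.image a, ?_, LinearMap.id - σ ∘ₗ U.mkQ, ?_, ?_, ?_⟩
  · rw [Finset.card_image_of_injective _ ha, Finset.card_univ, ← Module.finrank_eq_card_basis b,
      Submodule.finrank_quotient_add_finrank]
    simp
  · intro v
    rw [← Submodule.Quotient.mk_eq_zero, ← Submodule.mkQ_apply]
    have := LinearMap.congr_fun hσ (U.mkQ v)
    simp only [LinearMap.comp_apply, LinearMap.id_apply] at this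
    simp only [LinearMap.sub_apply, LinearMap.comp_apply, LinearMap.id_apply, map_sub, this, sub_self]
  · intro v hv
    have : U.mkQ v = 0 := by simpa using hv
    simp [LinearMap.comp_apply, this, -Submodule.mkQ_apply]
  · intro v j hj
    have : ∀ w, σ w j = 0 := by
      intro w
      simp only [σ, Module.Basis.constr_apply_fintype, Finset.sum_apply, Pi.smul_apply]
      apply Finset.sum_eq_zero
      intro k _
      have : j ≠ a k := fun h => hj (by simp [h])
      simp [Pi.single_apply, this]
    simp [LinearMap.comp_apply, this, -Submodule.mkQ_apply]

/-- A generic complex point stays invertible under a linear map. -/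
lemma exists_complex_point {K ι : Type} [Field K] [Algebra ℂ K] [Fintype ι] [DecidableEq ι] (n : ℕ)
    (L : (ι → K) →ₗ[K] Matrix (Fin n) (Fin n) K) (v : ι → K) (hv : (L v).det ≠ 0) :
    ∃ w : ι → ℂ, (L (fun i => algebraMap ℂ K (w i))).det ≠ 0 := by
  let M : Matrix (Fin n) (Fin n) (MvPolynomial ι K) :=
    Matrix.of fun i j => ∑ k, MvPolynomial.C (L (Pi.single k 1) i j) * MvPolynomial.X k
  have hM : ∀ u : ι → K, MvPolynomial.eval u M.det = (L u).det := by
    intro u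
    rw [RingHom.map_det]
    congr 1
    ext i j
    have hu : u = ∑ k, u k • (Pi.single k 1 : ι → K) := by
      funext x; simp [Finset.sum_apply, Pi.single_apply]
    conv_rhs => rw [hu, map_sum]
    simp [M, Matrix.sum_apply, mul_comm]
  by_contra! hcon
  apply hv
  have h0 : M.det = 0 := by
    apply MvPolynomial.funext_set (fun _ : ι => Set.range (algebraMap ℂ K))
    · intro _
      exact Set.infinite_range_of_injective (algebraMap ℂ K).injective
    · intro x hx
      have : ∀ i, ∃ y, algebraMap ℂ K y = x i := fun i => hx i trivial
      choose w hw using this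
      have hx' : x = fun i => algebraMap ℂ K (w i) := by funext i; rw [hw]
      rw [hM, hx', hcon, map_zero]
  rw [← hM, h0, map_zero]

lemma span_complex {K : Type} [Field K] [Algebra ℂ K] (n : ℕ) (J P : Matrix (Fin n) (Fin n) ℂ)
    (e : Matrix (Fin n) (Fin n) K)
    (h1 : e * J.map (algebraMap ℂ K) = J.map (algebraMap ℂ K) * e)
    (h2 : e * P.map (algebraMap ℂ K) = P.map (algebraMap ℂ K) * e) :
    e ∈ Submodule.span K ((fun A : Matrix (Fin n) (Fin n) ℂ => A.map (algebraMap ℂ K)) ''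
      {A | A * J = J * A ∧ A * P = P * A}) := by
  classical
  let β := Module.Basis.ofVectorSpace ℂ K
  let A := fun α => e.map (β.coord α)
  have hA : ∀ (α) (J : Matrix (Fin n) (Fin n) ℂ), e * J.map (algebraMap ℂ K) = J.map (algebraMap ℂ K) * e →
      A α * J = J * A α := by
    intro α J h
    ext i j
    have := congrArg (β.coord α) (congrFun (congrFun h i) j)
    simp only [Matrix.mul_apply, Matrix.map_apply, map_sum] at this
    simp only [Matrix.mul_apply, Matrix.map_apply, A]
    convert this using 2 with x _ x _
    · rw [mul_comm (e i x), ← Algebra.smul_def, map_smul, smul_eq_mul, mul_comm]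
    · rw [← Algebra.smul_def, map_smul, smul_eq_mul]
  let T : Finset _ := Finset.univ.biUnion fun p : Fin n × Fin n => (β.repr (e p.1 p.2)).support
  have he : e = ∑ α ∈ T, β α • (A α).map (algebraMap ℂ K) := by
    ext i j
    rw [Matrix.sum_apply]
    simp only [Matrix.smul_apply, Matrix.map_apply, A]
    conv_lhs => rw [← β.linearCombination_repr (e i j), Finsupp.linearCombination_apply]
    rw [Finsupp.sum_of_support_subset (s := T)]
    · apply Finset.sum_congr rfl
      intro α _
      rw [Algebra.smul_def, smul_eq_mul, mul_comm]
      rfl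
    · exact Finset.subset_biUnion_of_mem (fun p : Fin n × Fin n => (β.repr (e p.1 p.2)).support) (Finset.mem_univ (i, j))
    · simp
  rw [he]
  refine Submodule.sum_mem _ fun α _ => Submodule.smul_mem _ _ (Submodule.subset_span ⟨A α, ⟨hA α J h1, hA α P h2⟩, rfl⟩)

/-- the commutant of two complex matrices inside `Mₙ(K)` -/
def commut (K : Type) [Field K] [Algebra ℂ K] (n : ℕ) (J P : Matrix (Fin n) (Fin n) ℂ) :
    Submodule K (Matrix (Fin n) (Fin n) K) where
  carrier := {e | e * J.map (algebraMap ℂ K) = J.map (algebraMap ℂ K) * e ∧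
    e * P.map (algebraMap ℂ K) = P.map (algebraMap ℂ K) * e}
  add_mem' := by
    rintro a b ⟨h1, h2⟩ ⟨h3, h4⟩
    exact ⟨by rw [add_mul, mul_add, h1, h3], by rw [add_mul, mul_add, h2, h4]⟩
  zero_mem' := by simp
  smul_mem' := by
    rintro c a ⟨h1, h2⟩
    exact ⟨by rw [Matrix.smul_mul, Matrix.mul_smul, h1], by rw [Matrix.smul_mul, Matrix.mul_smul, h2]⟩

lemma entries_mul {K : Type} [Field K] [Algebra ℂ K] {n : ℕ} (F : IntermediateField ℂ K)
    {A B : Matrix (Fin n) (Fin n) K} (hA : ∀ i j, A i j ∈ F) (hB : ∀ i j, B i j ∈ F) :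
    ∀ i j, (A * B) i j ∈ F := by
  intro i j
  rw [Matrix.mul_apply]
  exact sum_mem fun k _ => mul_mem (hA _ _) (hB _ _)

lemma entries_map {K : Type} [Field K] [Algebra ℂ K] {n : ℕ} (F : IntermediateField ℂ K)
    (A : Matrix (Fin n) (Fin n) ℂ) : ∀ i j, (A.map (algebraMap ℂ K)) i j ∈ F := by
  intro i j
  exact F.algebraMap_mem _

lemma entries_inv {K : Type} [Field K] [Algebra ℂ K] {n : ℕ} (F : IntermediateField ℂ K)
    {A : Matrix (Fin n) (Fin n) K} (hA : ∀ i j, A i j ∈ F) (hdet : A.det ≠ 0) :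
    ∀ i j, A⁻¹ i j ∈ F := by
  let A' : Matrix (Fin n) (Fin n) F := Matrix.of fun i j => ⟨A i j, hA i j⟩
  have h1 : A'.map (algebraMap F K) = A := by ext i j; rfl
  have hd : A.det = algebraMap F K A'.det := by rw [← h1, RingHom.map_det]; rfl
  have hd' : A'.det ≠ 0 := by
    intro h; apply hdet; rw [hd, h, map_zero]
  have h2 : A * (A'⁻¹).map (algebraMap F K) = 1 := by
    conv_lhs => rw [← h1]
    rw [← Matrix.map_mul, Matrix.mul_nonsing_inv _ (isUnit_iff_ne_zero.2 hd')]
    exact Matrix.map_one _ (map_zero _) (map_one _)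
  rw [Matrix.inv_eq_right_inv h2]
  intro i j
  exact (A'⁻¹ i j).2

lemma normal_bound {K : Type} [Field K] [Algebra ℂ K] (n : ℕ) (J P g g' : Matrix (Fin n) (Fin n) ℂ)
    (hg : g * g' = 1) (h W0 : Matrix (Fin n) (Fin n) K) (hh : h.det ≠ 0)
    (hW : ∀ e e', e ∈ commut K n J P → e * e' = 1 →
      g'.map (algebraMap ℂ K) * (e' * W0 * e) ∈ commut K n J P) :
    ∃ s : Finset K, s.card ≤ n ^ 2 ∧ ∃ h1 W1 : Matrix (Fin n) (Fin n) K, h1.det ≠ 0 ∧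
      (∀ i j, h1 i j ∈ IntermediateField.adjoin ℂ (s : Set K)) ∧
      (∀ i j, W1 i j ∈ IntermediateField.adjoin ℂ (s : Set K)) ∧
      h * J.map (algebraMap ℂ K) * h⁻¹ = h1 * J.map (algebraMap ℂ K) * h1⁻¹ ∧
      h * P.map (algebraMap ℂ K) * h⁻¹ = h1 * P.map (algebraMap ℂ K) * h1⁻¹ ∧
      h * W0 * h⁻¹ = h1 * W1 * h1⁻¹ := by
  classical
  set E := commut K n J P with hE
  -- basis of E made of complex matrices
  let S : Set (Matrix (Fin n) (Fin n) K) :=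
    (fun A : Matrix (Fin n) (Fin n) ℂ => A.map (algebraMap ℂ K)) '' {A | A * J = J * A ∧ A * P = P * A}
  have hSE : Submodule.span K S = E := by
    apply le_antisymm
    · rw [Submodule.span_le]
      rintro _ ⟨A, ⟨h1, h2⟩, rfl⟩
      exact ⟨by rw [← Matrix.map_mul, h1, Matrix.map_mul], by rw [← Matrix.map_mul, h2, Matrix.map_mul]⟩
    · rintro e ⟨h1, h2⟩
      exact span_complex n J P e h1 h2
  obtain ⟨b, hbS, hbspan, hbli⟩ := exists_linearIndependent K S
  have hbfin : b.Finite := hbli.setFinite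
  have : Fintype b := hbfin.fintype
  have hbcard : Fintype.card b = Module.finrank K E := by
    rw [← hSE, ← hbspan]
    have := finrank_span_eq_card hbli
    rw [Subtype.range_coe] at this
    exact this.symm
  -- the coordinate projection
  let eqv : Matrix (Fin n) (Fin n) K ≃ₗ[K] (Fin n × Fin n → K) := (LinearEquiv.curry K K (Fin n) (Fin n)).symm
  have heqv : ∀ A p, eqv A p = A p.1 p.2 := fun A p => rfl
  let lm : Matrix (Fin n) (Fin n) K →ₗ[K] Matrix (Fin n) (Fin n) K := LinearMap.mulLeft K h
  have hhu : IsUnit h.det := isUnit_iff_ne_zero.2 hh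
  have hlm : Function.Injective (eqv.toLinearMap ∘ₗ lm) := by
    intro a c hac
    have h1 : h * a = h * c := eqv.injective hac
    have := congrArg (fun x => h⁻¹ * x) h1
    simpa [← mul_assoc, Matrix.nonsing_inv_mul _ hhu] using this
  let U : Submodule K (Fin n × Fin n → K) := E.map (eqv.toLinearMap ∘ₗ lm)
  have hU : Module.finrank K U = Module.finrank K E :=
    LinearEquiv.finrank_eq (Submodule.equivMapOfInjective _ hlm E).symm
  obtain ⟨t, ht, L, hL1, hL2, hL3⟩ := coord_proj U
  have h1E : (1 : Matrix (Fin n) (Fin n) K) ∈ E := ⟨by simp, by simp⟩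
  have hhU : eqv h ∈ U := ⟨1, h1E, by simp [lm]⟩
  obtain ⟨w, hw⟩ := exists_complex_point n (eqv.symm.toLinearMap ∘ₗ L) (eqv h) (by
    simp only [LinearMap.comp_apply, LinearEquiv.coe_coe]
    rw [hL2 _ hhU]
    simpa using hh)
  set v : Fin n × Fin n → K := fun i => algebraMap ℂ K (w i) with hv
  let h1 : Matrix (Fin n) (Fin n) K := eqv.symm (L v)
  have hh1 : h1.det ≠ 0 := hw
  obtain ⟨e, heE, he⟩ := hL1 v
  have he1 : h * e = h1 := by
    change eqv (h * e) = L v at he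
    rw [← eqv.symm_apply_apply (h * e), he]
  have hedet : IsUnit e.det := by
    rw [isUnit_iff_ne_zero]
    intro h0
    apply hh1
    rw [← he1, Matrix.det_mul, h0, mul_zero]
  have hW1 := hW e e⁻¹ heE (Matrix.mul_nonsing_inv _ hedet)
  set W1 := e⁻¹ * W0 * e with hW1def
  rw [← hSE, ← hbspan, ← Subtype.range_coe (s := b)] at hW1
  obtain ⟨c, hc⟩ := (Submodule.mem_span_range_iff_exists_fun K).1 hW1
  let s : Finset K := t.image (fun p => h1 p.1 p.2) ∪ Finset.univ.image c
  have hscard : s.card ≤ n ^ 2 := by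
    refine (Finset.card_union_le _ _).trans ?_
    have h1 := Finset.card_image_le (s := t) (f := (fun p => h1 p.1 p.2))
    have h2 := Finset.card_image_le (s := (Finset.univ : Finset b)) (f := c)
    rw [Finset.card_univ, hbcard] at h2
    rw [hU, Fintype.card_prod, Fintype.card_fin, ← pow_two] at ht
    omega
  have hJe := heE.1
  have hPe := heE.2
  have hinv : h1⁻¹ = e⁻¹ * h⁻¹ := by rw [← he1, Matrix.mul_inv_rev]
  have hconj : ∀ A B : Matrix (Fin n) (Fin n) K, e * B = A * e → h * A * h⁻¹ = h1 * B * h1⁻¹ := by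
    intro A B hAB
    rw [hinv, ← he1]
    calc h * A * h⁻¹ = h * A * (e * e⁻¹) * h⁻¹ := by rw [Matrix.mul_nonsing_inv _ hedet, mul_one]
      _ = h * (A * e) * e⁻¹ * h⁻¹ := by simp only [mul_assoc]
      _ = _ := by rw [← hAB]; simp only [mul_assoc]
  refine ⟨s, hscard, h1, W1, hh1, ?_, ?_, hconj _ _ hJe, hconj _ _ hPe, hconj _ _ ?_⟩
  · intro i j
    by_cases hij : (i, j) ∈ t
    · apply IntermediateField.subset_adjoin
      simp only [s, Finset.coe_union, Set.mem_union, Finset.coe_image, Set.mem_image]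
      exact Or.inl ⟨(i, j), hij, rfl⟩
    · have := hL3 v (i, j) hij
      have h2 : h1 i j = L v (i, j) := by
        rw [← heqv h1 (i, j)]; simp [h1]
      rw [h2, this]
      exact IntermediateField.algebraMap_mem _ _
  · have hW2 : W1 = g.map (algebraMap ℂ K) * (∑ i, c i • (i : Matrix (Fin n) (Fin n) K)) := by
      rw [hc, ← mul_assoc, ← Matrix.map_mul, hg, Matrix.map_one _ (map_zero _) (map_one _), one_mul]
    rw [hW2]
    apply entries_mul _ (entries_map _ _)
    intro i j
    rw [Matrix.sum_apply]
    refine sum_mem fun k _ => ?_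
    rw [Matrix.smul_apply, smul_eq_mul]
    apply mul_mem
    · apply IntermediateField.subset_adjoin
      simp [s]
    · obtain ⟨A, -, hA⟩ := hbS k.2
      rw [← hA]
      exact entries_map _ _ i j
  · rw [hW1def, ← mul_assoc, ← mul_assoc, Matrix.mul_nonsing_inv _ hedet, one_mul]

lemma trunc_basis (K : Type) [Field K] (k : ℕ) :
    ∃ b : Module.Basis (Fin k) K (AdjoinRoot ((Polynomial.X : Polynomial K) ^ k)),
      ∀ j, b j = AdjoinRoot.mk _ (Polynomial.X ^ (j : ℕ)) := by
  refine ⟨(AdjoinRoot.powerBasis' (g := (Polynomial.X : Polynomial K) ^ k) (Polynomial.monic_X_pow _)).basis.reindex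
      (finCongr (by simp)), ?_⟩
  intro j
  rw [Module.Basis.reindex_apply, PowerBasis.coe_basis, AdjoinRoot.powerBasis'_gen, map_pow, AdjoinRoot.mk_X]
  rfl

lemma jordan_nilp {K V : Type} [Field K] [AddCommGroup V] [Module K V] [FiniteDimensional K V]
    (f : Module.End K V) (hf : IsNilpotent f) :
    ∃ (ι : Type) (_ : Fintype ι) (b : Module.Basis ι K V) (d : ι → ℕ),
      ∀ j, f (b j) = 0 ∨ ∃ i, f (b j) = b i ∧ d i = d j + 1 := by
  classical
  obtain ⟨N, hN⟩ := hf
  have htors : Module.IsTorsion' (Module.AEval' f) (Submonoid.powers (Polynomial.X : Polynomial K)) := by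
    intro m
    obtain ⟨v, rfl⟩ := (Module.AEval'.of f).surjective m
    refine ⟨⟨Polynomial.X ^ N, N, rfl⟩, ?_⟩
    change (Polynomial.X ^ N : Polynomial K) • (Module.AEval'.of f v) = 0
    rw [Module.AEval'.X_pow_smul_of, hN]
    simp
  obtain ⟨r, k, ⟨e⟩⟩ := Module.torsion_by_prime_power_decomposition
    (R := Polynomial K) (M := Module.AEval' f) (Polynomial.prime_X.irreducible) htors
  have hex : ∀ i : Fin r, ∃ b : Module.Basis (Fin (k i)) K (Polynomial K ⧸ Polynomial K ∙ (Polynomial.X : Polynomial K) ^ (k i)),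
    ∀ j, b j = Ideal.Quotient.mk (Ideal.span {(Polynomial.X : Polynomial K) ^ (k i)}) (Polynomial.X ^ (j : ℕ)) :=
    fun i => trunc_basis K (k i)
  choose B hB using hex
  let BB : Module.Basis (Σ i, Fin (k i)) K (DirectSum (Fin r) fun i => (Polynomial K ⧸ Polynomial K ∙ (Polynomial.X : Polynomial K) ^ (k i))) :=
    DFinsupp.basis B
  have hBB : ∀ i j, BB ⟨i, j⟩ = DirectSum.lof (Polynomial K) _ _ i (B i j) := by
    intro i j
    change BB.repr.symm _ = _
    rw [LinearEquiv.symm_apply_eq]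
    change _ = (sigmaFinsuppLequivDFinsupp K).symm (DFinsupp.mapRange.linearEquiv (fun i => (B i).repr) (DFinsupp.single i (B i j)))
    rw [DFinsupp.mapRange.linearEquiv_apply, DFinsupp.mapRange_single, LinearEquiv.eq_symm_apply]
    simp
  let e' := e.restrictScalars K
  let b := (BB.map e'.symm).map (Module.AEval'.of f).symm
  have hb : ∀ i j, Module.AEval'.of f (b ⟨i, j⟩) = e.symm (DirectSum.lof (Polynomial K) _ _ i (B i j)) := by
    intro i j
    rw [← hBB]
    simp [b, e']
  refine ⟨Σ i, Fin (k i), inferInstance, b, fun p => p.2, ?_⟩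
  rintro ⟨i, j⟩
  have h1 : Module.AEval'.of f (f (b ⟨i, j⟩)) = e.symm (DirectSum.lof (Polynomial K) _ _ i
      (Ideal.Quotient.mk (Ideal.span {(Polynomial.X : Polynomial K) ^ (k i)}) (Polynomial.X ^ (j + 1 : ℕ)))) := by
    rw [← Module.AEval'.X_smul_of, hb, ← map_smul, ← map_smul, hB, pow_succ']
    rfl
  by_cases hj : (j : ℕ) + 1 < k i
  · right
    refine ⟨⟨i, ⟨j + 1, hj⟩⟩, ?_, rfl⟩
    apply (Module.AEval'.of f).injective
    rw [h1, hb, hB]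
  · left
    apply (Module.AEval'.of f).injective
    have : (j : ℕ) + 1 = k i := by have := j.2; omega
    rw [h1, this, Ideal.Quotient.eq_zero_iff_mem.2 (Ideal.mem_span_singleton_self _)]
    simp

lemma nilp_of_qcomm {K V : Type} [Field K] [AddCommGroup V] [Module K V] [FiniteDimensional K V]
    (q : K) (hq : q ≠ 0) (hq' : ∀ k : ℕ, 1 ≤ k → q ^ k ≠ 1) (a b : Module.End K V)
    (ha : Function.Injective a) (hab : a * b = q • (b * a)) : IsNilpotent b := by
  have hs : SemiconjBy a b (q • b) := by
    rw [SemiconjBy, hab, smul_mul_assoc]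
  set p := minpoly K b with hp
  have hb : IsIntegral K b := Algebra.IsIntegral.isIntegral b
  have hmonic : p.Monic := minpoly.monic hb
  have h1 : Polynomial.aeval (q • b) p = 0 := by
    have h2 : Polynomial.aeval (q • b) p * a = a * Polynomial.aeval b p := by
      rw [Polynomial.aeval_eq_sum_range, Polynomial.aeval_eq_sum_range, Finset.sum_mul, Finset.mul_sum]
      apply Finset.sum_congr rfl
      intro j _
      rw [smul_mul_assoc, mul_smul_comm, (hs.pow_right j).eq]
    rw [minpoly.aeval, mul_zero] at h2
    have hsurj : Function.Surjective a := LinearMap.injective_iff_surjective.1 ha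
    ext v
    obtain ⟨w, rfl⟩ := hsurj v
    exact LinearMap.congr_fun h2 w
  have h3 : Polynomial.aeval b (p.comp (Polynomial.C q * Polynomial.X) - Polynomial.C (q ^ p.natDegree) * p) = 0 := by
    rw [map_sub, Polynomial.aeval_comp, map_mul, map_mul, minpoly.aeval, mul_zero, sub_zero,
      Polynomial.aeval_C, Polynomial.aeval_X, ← Algebra.smul_def, h1]
  have h4 : p.comp (Polynomial.C q * Polynomial.X) - Polynomial.C (q ^ p.natDegree) * p = 0 := by
    by_contra hne
    have hle := minpoly.degree_le_of_ne_zero K b hne h3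
    rw [← hp, Polynomial.degree_eq_natDegree hmonic.ne_zero] at hle
    refine absurd hle (not_le.2 ?_)
    rw [Polynomial.degree_lt_iff_coeff_zero]
    intro m hm
    rw [Polynomial.coeff_sub, Polynomial.comp_C_mul_X_coeff, Polynomial.coeff_C_mul]
    rcases hm.eq_or_lt with h | h
    · rw [← h]; ring
    · rw [Polynomial.coeff_eq_zero_of_natDegree_lt h]; ring
  have h5 : p = Polynomial.X ^ p.natDegree := by
    ext m
    rw [Polynomial.coeff_X_pow]
    have h6 := congrArg (fun r => Polynomial.coeff r m) h4
    simp only [Polynomial.coeff_sub, Polynomial.comp_C_mul_X_coeff, Polynomial.coeff_C_mul, Polynomial.coeff_zero] at h6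
    split_ifs with hm
    · rw [hm]; exact hmonic
    · rcases lt_or_gt_of_ne hm with h | h
      · have h7 : p.coeff m * q ^ m * (1 - q ^ (p.natDegree - m)) = 0 := by
          rw [← h6]
          have : q ^ p.natDegree = q ^ m * q ^ (p.natDegree - m) := by
            rw [← pow_add]; congr 1; omega
          rw [this]; ring
        have h8 := hq' (p.natDegree - m) (by omega)
        rcases mul_eq_zero.1 h7 with h | h
        · rcases mul_eq_zero.1 h with h | h
          · exact h
          · exact absurd h (pow_ne_zero _ hq)
        · exact absurd (sub_eq_zero.1 h).symm h8
      · exact Polynomial.coeff_eq_zero_of_natDegree_lt h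
  refine ⟨p.natDegree, ?_⟩
  have h9 := minpoly.aeval K b
  rw [← hp, h5] at h9
  simpa using h9

lemma fitting_basis {K V : Type} [Field K] [AddCommGroup V] [Module K V] [FiniteDimensional K V]
    (n : ℕ) (hn : Module.finrank K V = n)
    (q : K) (hq : q ≠ 0) (hq' : ∀ k : ℕ, 1 ≤ k → q ^ k ≠ 1) (x y : Module.End K V)
    (hxy : x * y = q • (y * x)) :
    ∃ (b : Module.Basis (Fin n) K V) (ε : Fin n → Bool) (d : Fin n → ℕ),
      (∀ i j, ε i ≠ ε j → b.repr (x (b j)) i = 0 ∧ b.repr (y (b j)) i = 0) ∧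
      ∀ j, (if ε j then x (b j) else y (b j)) = 0 ∨
        ∃ i, (if ε j then x (b j) else y (b j)) = b i ∧ d i = d j + 1 := by
  classical
  obtain ⟨k0, hk0⟩ := Filter.eventually_atTop.1 (LinearMap.eventually_isCompl_ker_pow_range_pow x)
  set k := k0 + 1 with hk
  have hc : IsCompl (LinearMap.ker (x ^ k)) (LinearMap.range (x ^ k)) := hk0 k (by omega)
  set V0 := LinearMap.ker (x ^ k) with hV0
  set V1 := LinearMap.range (x ^ k) with hV1
  have hpow : x ^ k * y = q ^ k • (y * x ^ k) := by
    have hs : SemiconjBy y (q • x) x := by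
      rw [SemiconjBy, hxy, mul_smul_comm]
    have := (hs.pow_right k).eq
    rw [← this, smul_pow, mul_smul_comm]
  have hpow' : ∀ v, (x ^ k) (y v) = q ^ k • y ((x ^ k) v) := fun v => LinearMap.congr_fun hpow v
  have hxc : ∀ v, (x ^ k) (x v) = x ((x ^ k) v) := fun v =>
    LinearMap.congr_fun ((Commute.refl x).pow_left k).eq v
  have hx0 : ∀ v ∈ V0, x v ∈ V0 := by
    intro v hv
    rw [hV0, LinearMap.mem_ker] at hv ⊢
    rw [hxc, hv, map_zero]
  have hy0 : ∀ v ∈ V0, y v ∈ V0 := by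
    intro v hv
    rw [hV0, LinearMap.mem_ker] at hv ⊢
    rw [hpow', hv, map_zero, smul_zero]
  have hx1 : ∀ v ∈ V1, x v ∈ V1 := by
    rintro _ ⟨v, rfl⟩
    exact ⟨x v, hxc v⟩
  have hy1 : ∀ v ∈ V1, y v ∈ V1 := by
    rintro _ ⟨v, rfl⟩
    refine ⟨(q ^ k)⁻¹ • y v, ?_⟩
    rw [map_smul, hpow', smul_smul, inv_mul_cancel₀ (pow_ne_zero _ hq), one_smul]
  have hnil0 : IsNilpotent (x.restrict hx0) := by
    refine ⟨k, ?_⟩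
    rw [Module.End.pow_restrict]
    ext v
    have : (x ^ k) (v : V) = 0 := v.2
    simpa using this
  have hnil1 : IsNilpotent (y.restrict hy1) := by
    apply nilp_of_qcomm q hq hq' (x.restrict hx1)
    · rw [injective_iff_map_eq_zero]
      intro v hv
      have h1 : x v = 0 := congrArg Subtype.val hv
      have h2 : (v : V) ∈ V0 := by
        rw [hV0, LinearMap.mem_ker, hk, pow_succ, Module.End.mul_apply, h1, map_zero]
      exact Subtype.ext (Submodule.disjoint_def.1 hc.disjoint _ h2 v.2)
    · ext v
      exact LinearMap.congr_fun hxy v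
  obtain ⟨ι0, _, b0, d0, hb0⟩ := jordan_nilp _ hnil0
  obtain ⟨ι1, _, b1, d1, hb1⟩ := jordan_nilp _ hnil1
  let e := Submodule.prodEquivOfIsCompl V0 V1 hc
  let B := (b0.prod b1).map e
  have hcard : Fintype.card (ι0 ⊕ ι1) = Fintype.card (Fin n) := by
    rw [← Module.finrank_eq_card_basis B, hn, Fintype.card_fin]
  let σ : ι0 ⊕ ι1 ≃ Fin n := Fintype.equivOfCardEq hcard
  have hBl : ∀ i, B (Sum.inl i) = b0 i := by intro i; simp [B, e]
  have hBr : ∀ i, B (Sum.inr i) = b1 i := by intro i; simp [B, e]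
  have hr0 : ∀ v ∈ V0, ∀ i, B.repr v (Sum.inr i) = 0 := by
    intro v hv i
    have : e.symm v = (⟨v, hv⟩, 0) := Submodule.prodEquivOfIsCompl_symm_apply_left V0 V1 hc ⟨v, hv⟩
    simp [B, this]
  have hr1 : ∀ v ∈ V1, ∀ i, B.repr v (Sum.inl i) = 0 := by
    intro v hv i
    have : e.symm v = (0, ⟨v, hv⟩) := Submodule.prodEquivOfIsCompl_symm_apply_right V0 V1 hc ⟨v, hv⟩
    simp [B, this]
  refine ⟨B.reindex σ, fun i => (σ.symm i).isLeft, fun i => Sum.elim d0 d1 (σ.symm i), ?_, ?_⟩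
  · intro i j
    obtain ⟨i, rfl⟩ := σ.surjective i
    obtain ⟨j, rfl⟩ := σ.surjective j
    simp only [Equiv.symm_apply_apply, Module.Basis.reindex_apply, Module.Basis.repr_reindex_apply]
    rcases i with i | i <;> rcases j with j | j
    · simp
    · intro _
      rw [hBr]
      exact ⟨hr1 _ (hx1 _ (b1 j).2) i, hr1 _ (hy1 _ (b1 j).2) i⟩
    · intro _
      rw [hBl]
      exact ⟨hr0 _ (hx0 _ (b0 j).2) i, hr0 _ (hy0 _ (b0 j).2) i⟩
    · simp
  · intro j
    obtain ⟨j, rfl⟩ := σ.surjective j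
    simp only [Equiv.symm_apply_apply, Module.Basis.reindex_apply]
    rcases j with j | j
    · simp only [Sum.isLeft_inl, if_true, hBl]
      rcases hb0 j with h | ⟨i, h, hd⟩
      · left; exact congrArg Subtype.val h
      · right
        refine ⟨σ (Sum.inl i), ?_, ?_⟩
        · rw [Equiv.symm_apply_apply, hBl]; exact congrArg Subtype.val h
        · simpa using hd
    · simp only [Sum.isLeft_inr, hBr]
      rcases hb1 j with h | ⟨i, h, hd⟩
      · left; exact congrArg Subtype.val h
      · right
        refine ⟨σ (Sum.inr i), ?_, ?_⟩
        · rw [Equiv.symm_apply_apply, hBr]; exact congrArg Subtype.val h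
        · simpa using hd

lemma key_field (n : ℕ) (q : ℂ) (hq : q ≠ 0)
    (hq' : ∀ k : ℕ, 1 ≤ k → q ^ k ≠ 1) (K : Type) [Field K] [Algebra ℂ K]
    (X Y : Matrix (Fin n) (Fin n) K) (h : X * Y = algebraMap ℂ K q • (Y * X)) :
    ∃ s : Finset K, s.card ≤ n ^ 2 ∧
      ∀ i j, X i j ∈ IntermediateField.adjoin ℂ (s : Set K) ∧
        Y i j ∈ IntermediateField.adjoin ℂ (s : Set K) := by
  classical
  set Q := algebraMap ℂ K q with hQ
  have hQ0 : Q ≠ 0 := by rw [hQ]; simpa using hq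
  have hQ' : ∀ k : ℕ, 1 ≤ k → Q ^ k ≠ 1 := by
    intro k hk h1
    apply hq' k hk
    apply (algebraMap ℂ K).injective
    rw [map_pow, map_one]; exact h1
  let x := Matrix.toLin' X
  let y := Matrix.toLin' Y
  have hxy : x * y = Q • (y * x) := by
    have := congrArg Matrix.toLin' h
    rw [map_smul, Matrix.toLin'_mul, Matrix.toLin'_mul] at this
    exact this
  obtain ⟨b, ε, d, hb1, hb2⟩ := fitting_basis n (by simp) Q hQ0 hQ' x y hxy
  let z : Fin n → (Fin n → K) := fun j => if ε j then x (b j) else y (b j)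
  let w : Fin n → (Fin n → K) := fun j => if ε j then y (b j) else x (b j)
  let J : Matrix (Fin n) (Fin n) ℂ := Matrix.of fun i j =>
    if z j = b i ∧ d i = d j + 1 then 1 else 0
  let W0 : Matrix (Fin n) (Fin n) K := Matrix.of fun i j => b.repr (w j) i
  let P : Matrix (Fin n) (Fin n) ℂ := Matrix.diagonal fun i => if ε i then 1 else 0
  let g : Matrix (Fin n) (Fin n) ℂ := Matrix.diagonal fun i => if ε i then (q ^ d i)⁻¹ else q ^ d i
  let g' : Matrix (Fin n) (Fin n) ℂ := Matrix.diagonal fun i => if ε i then q ^ d i else (q ^ d i)⁻¹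
  have hJ : ∀ i j, b.repr (z j) i = algebraMap ℂ K (J i j) := by
    intro i j
    rcases hb2 j with h0 | ⟨i', h1, h2⟩
    · have h0 : z j = 0 := h0
      have : ¬ (z j = b i ∧ d i = d j + 1) := fun hh => b.ne_zero i (by rw [← hh.1, h0])
      simp only [J, Matrix.of_apply, if_neg this]
      simp [h0]
    · have h1 : z j = b i' := h1
      by_cases hi : i = i'
      · subst hi
        simp [J, h1, h2]
      · have : ¬ (z j = b i ∧ d i = d j + 1) := fun hh => hi (b.injective (by rw [← hh.1, h1]))
        simp only [J, Matrix.of_apply, if_neg this]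
        rw [h1]
        simp [Finsupp.single_apply, Ne.symm hi]
  have hz0 : ∀ i j, ε i ≠ ε j → b.repr (z j) i = 0 := by
    intro i j hij
    by_cases hj : ε j
    · simp only [z, if_pos hj]; exact (hb1 i j hij).1
    · simp only [z, if_neg hj]; exact (hb1 i j hij).2
  have hw0 : ∀ i j, ε i ≠ ε j → b.repr (w j) i = 0 := by
    intro i j hij
    by_cases hj : ε j
    · simp only [w, if_pos hj]; exact (hb1 i j hij).2
    · simp only [w, if_neg hj]; exact (hb1 i j hij).1
  have hJ0 : ∀ i j, J i j ≠ 0 → ε i = ε j ∧ d i = d j + 1 := by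
    intro i j hij
    constructor
    · by_contra hne
      apply hij
      apply (algebraMap ℂ K).injective
      rw [← hJ, hz0 i j hne, map_zero]
    · by_contra hne
      apply hij
      simp [J, hne]
  let Jm := J.map (algebraMap ℂ K)
  let Pm := P.map (algebraMap ℂ K)
  have hPm : Pm = Matrix.diagonal fun i => if ε i then 1 else 0 := by
    simp only [Pm, P]
    rw [Matrix.diagonal_map (map_zero _)]
    congr 1; funext i; split_ifs <;> simp
  -- conjugation
  let H : Matrix (Fin n) (Fin n) K := (Pi.basisFun K (Fin n)).toMatrix b
  let H' : Matrix (Fin n) (Fin n) K := b.toMatrix (Pi.basisFun K (Fin n))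
  have hHH : H * H' = 1 := Module.Basis.toMatrix_mul_toMatrix_flip _ _
  have hHH' : H' * H = 1 := Module.Basis.toMatrix_mul_toMatrix_flip _ _
  have hHinv : H⁻¹ = H' := Matrix.inv_eq_right_inv hHH
  have hHdet : H.det ≠ 0 := by
    intro h0
    have := congrArg Matrix.det hHH
    rw [Matrix.det_mul, h0, zero_mul, Matrix.det_one] at this
    exact zero_ne_one this
  have hconj : ∀ A : Matrix (Fin n) (Fin n) K, A = H * LinearMap.toMatrix b b (Matrix.toLin' A) * H⁻¹ := by
    intro A
    rw [hHinv]
    have := basis_toMatrix_mul_linearMap_toMatrix_mul_basis_toMatrix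
      (b := Pi.basisFun K (Fin n)) (b' := b) (c := Pi.basisFun K (Fin n)) (c' := b) (Matrix.toLin' A)
    simp only [H, H']
    rw [this, ← LinearMap.toMatrix'.symm_apply_apply (Matrix.toLin' A)]
    simp [LinearMap.toMatrix_eq_toMatrix']
  have hX' : LinearMap.toMatrix b b x = Pm * Jm + (1 - Pm) * W0 := by
    ext i j
    rw [LinearMap.toMatrix_apply, sub_mul, one_mul, hPm]
    simp only [Matrix.add_apply, Matrix.sub_apply, Matrix.diagonal_mul]
    by_cases hij : ε i = ε j
    · by_cases hj : ε j
      · have := hJ i j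
        simp only [z, if_pos hj] at this
        simp [hij, hj, this, Jm]
      · simp [hij, hj, W0, w]
    · rw [(hb1 i j hij).1]
      have h1 : Jm i j = 0 := by simp only [Jm, Matrix.map_apply]; rw [← hJ, hz0 i j hij]
      have h2 : W0 i j = 0 := hw0 i j hij
      simp [h1, h2]
  have hY' : LinearMap.toMatrix b b y = Pm * W0 + (1 - Pm) * Jm := by
    ext i j
    rw [LinearMap.toMatrix_apply, sub_mul, one_mul, hPm]
    simp only [Matrix.add_apply, Matrix.sub_apply, Matrix.diagonal_mul]
    by_cases hij : ε i = ε j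
    · by_cases hj : ε j
      · simp [hij, hj, W0, w]
      · have := hJ i j
        simp only [z, if_neg hj] at this
        simp [hij, hj, this, Jm]
    · rw [(hb1 i j hij).2]
      have h1 : Jm i j = 0 := by simp only [Jm, Matrix.map_apply]; rw [← hJ, hz0 i j hij]
      have h2 : W0 i j = 0 := hw0 i j hij
      simp [h1, h2]
  have hPP : Pm * Pm = Pm := by
    rw [hPm, Matrix.diagonal_mul_diagonal]; congr 1; funext i; split_ifs <;> simp
  have hPJ : Pm * Jm = Jm * Pm := by
    ext i j
    rw [hPm, Matrix.diagonal_mul, Matrix.mul_diagonal]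
    by_cases hij : ε i = ε j
    · rw [hij, mul_comm]
    · have h1 : Jm i j = 0 := by simp only [Jm, Matrix.map_apply]; rw [← hJ, hz0 i j hij]
      rw [h1]; ring
  have hPW : Pm * W0 = W0 * Pm := by
    ext i j
    rw [hPm, Matrix.diagonal_mul, Matrix.mul_diagonal]
    by_cases hij : ε i = ε j
    · rw [hij, mul_comm]
    · have h1 : W0 i j = 0 := hw0 i j hij
      rw [h1]; ring
  -- relations
  have hrel : (Pm * Jm + (1 - Pm) * W0) * (Pm * W0 + (1 - Pm) * Jm) =
      Q • ((Pm * W0 + (1 - Pm) * Jm) * (Pm * Jm + (1 - Pm) * W0)) := by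
    rw [← hX', ← hY', ← LinearMap.toMatrix_mul, ← LinearMap.toMatrix_mul, hxy, map_smul]
  have hP1 : Pm * (1 - Pm) = 0 := by rw [mul_sub, mul_one, hPP, sub_self]
  have hP2 : (1 - Pm) * Pm = 0 := by rw [sub_mul, one_mul, hPP, sub_self]
  have hP3 : (1 - Pm) * (1 - Pm) = 1 - Pm := by rw [mul_sub, mul_one, hP2, sub_zero]
  have hPJ' : (1 - Pm) * Jm = Jm * (1 - Pm) := by rw [mul_sub, sub_mul, hPJ, mul_one, one_mul]
  have hPW' : (1 - Pm) * W0 = W0 * (1 - Pm) := by rw [mul_sub, sub_mul, hPW, mul_one, one_mul]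
  have hexp : ∀ A B C D : Matrix (Fin n) (Fin n) K, Pm * A = A * Pm → (1 - Pm) * B = B * (1 - Pm) →
      (Pm * A + (1 - Pm) * B) * (Pm * C + (1 - Pm) * D) = Pm * (A * C) + (1 - Pm) * (B * D) := by
    intro A B C D hA hB
    have e1 : Pm * A * (Pm * C) = Pm * (A * C) := by
      rw [hA, mul_assoc, ← mul_assoc Pm Pm, hPP, ← mul_assoc, ← mul_assoc, hA]
    have e2 : Pm * A * ((1 - Pm) * D) = 0 := by
      rw [hA, mul_assoc, ← mul_assoc Pm, hP1, zero_mul, mul_zero]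
    have e3 : (1 - Pm) * B * (Pm * C) = 0 := by
      rw [hB, mul_assoc, ← mul_assoc _ Pm, hP2, zero_mul, mul_zero]
    have e4 : (1 - Pm) * B * ((1 - Pm) * D) = (1 - Pm) * (B * D) := by
      rw [hB, mul_assoc, ← mul_assoc (1 - Pm) (1 - Pm), hP3, ← mul_assoc, ← mul_assoc, hB]
    rw [add_mul, mul_add, mul_add, e1, e2, e3, e4]
    abel
  rw [hexp _ _ _ _ hPJ hPW', hexp _ _ _ _ hPW hPJ'] at hrel
  have hgg : g * g' = 1 := by
    simp only [g, g']
    rw [Matrix.diagonal_mul_diagonal, ← Matrix.diagonal_one]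
    congr 1
    funext i
    have := pow_ne_zero (d i) hq
    split_ifs <;> field_simp
  obtain ⟨s, hs, h1, W1, hh1, hF1, hF2, eJ, eP, eW⟩ := normal_bound n J P g g' hgg H W0 hHdet (by
    intro e e' he hee
    have hee' : e' * e = 1 := mul_eq_one_comm.1 hee
    have heJ : e * Jm = Jm * e := he.1
    have heP : e * Pm = Pm * e := he.2
    have heJ' : e' * Jm = Jm * e' := by
      calc e' * Jm = e' * (Jm * e) * e' := by rw [mul_assoc, mul_assoc, hee, mul_one]
        _ = (e' * e) * Jm * e' := by rw [← heJ]; simp only [mul_assoc]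
        _ = _ := by rw [hee', one_mul]
    have heP' : e' * Pm = Pm * e' := by
      calc e' * Pm = e' * (Pm * e) * e' := by rw [mul_assoc, mul_assoc, hee, mul_one]
        _ = (e' * e) * Pm * e' := by rw [← heP]; simp only [mul_assoc]
        _ = _ := by rw [hee', one_mul]
    set W := e' * W0 * e with hW
    have hWP : Pm * W = W * Pm := by
      simp only [hW]
      rw [← mul_assoc, ← mul_assoc, ← heP', mul_assoc e', hPW, mul_assoc _ e, heP]
      simp only [mul_assoc]
    have hJW : e' * (Jm * W0) * e = Jm * W := by
      simp only [hW]; rw [← mul_assoc, heJ']; simp only [mul_assoc]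
    have hWJ : e' * (W0 * Jm) * e = W * Jm := by
      simp only [hW]; rw [mul_assoc _ e, heJ]; simp only [mul_assoc]
    have hPe : ∀ A, e' * (Pm * A) * e = Pm * (e' * A * e) := by
      intro A; rw [← mul_assoc, heP']; simp only [mul_assoc]
    have hPe1 : ∀ A, e' * ((1 - Pm) * A) * e = (1 - Pm) * (e' * A * e) := by
      intro A
      rw [sub_mul, sub_mul, one_mul, one_mul, mul_sub, sub_mul, hPe]
    have hrel' : Pm * (Jm * W) + (1 - Pm) * (W * Jm) = Q • (Pm * (W * Jm) + (1 - Pm) * (Jm * W)) := by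
      have := congrArg (fun A => e' * A * e) hrel
      simp only [mul_smul_comm, smul_mul_assoc, mul_add, add_mul, hPe, hPe1, hJW, hWJ] at this
      simpa only [smul_add] using this
    have hg'm : g'.map (algebraMap ℂ K) = Matrix.diagonal fun i => if ε i then Q ^ d i else (Q ^ d i)⁻¹ := by
      simp only [g']
      rw [Matrix.diagonal_map (map_zero _)]
      congr 1; funext i; split_ifs <;> simp [hQ]
    refine ⟨?_, ?_⟩
    · change g'.map (algebraMap ℂ K) * W * Jm = Jm * (g'.map (algebraMap ℂ K) * W)
      rw [hg'm]
      ext i j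
      have hij := congrFun (congrFun hrel' i) j
      rw [sub_mul, sub_mul, one_mul, one_mul, hPm] at hij
      simp only [Matrix.add_apply, Matrix.sub_apply, Matrix.smul_apply, Matrix.diagonal_mul, smul_eq_mul] at hij
      rw [mul_assoc, Matrix.diagonal_mul]
      have hsum : ∀ c : K, (∀ k, Jm i k * (if ε k then Q ^ d k else (Q ^ d k)⁻¹) = c * Jm i k) →
          (Jm * (Matrix.diagonal (fun i => if ε i then Q ^ d i else (Q ^ d i)⁻¹) * W)) i j = c * (Jm * W) i j := by
        intro c hc
        rw [Matrix.mul_apply, Matrix.mul_apply, Finset.mul_sum]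
        apply Finset.sum_congr rfl
        intro k _
        rw [Matrix.diagonal_mul, ← mul_assoc, hc, mul_assoc]
      by_cases hi : ε i
      · rw [if_pos hi]
        simp only [hi, if_true, one_mul, sub_self, add_zero] at hij
        rw [hsum (Q ^ d i * Q⁻¹), hij]
        · field_simp
        · intro k
          by_cases hJk : J i k = 0
          · simp [Jm, hJk]
          · obtain ⟨h1, h2⟩ := hJ0 i k hJk
            rw [← h1, if_pos hi, h2, pow_succ]
            field_simp
      · rw [if_neg hi]
        simp only [hi, Bool.false_eq_true, if_false, zero_mul, sub_zero, zero_add] at hij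
        rw [hsum (Q * (Q ^ d i)⁻¹), hij]
        · ring
        · intro k
          by_cases hJk : J i k = 0
          · simp [Jm, hJk]
          · obtain ⟨h1, h2⟩ := hJ0 i k hJk
            rw [← h1, if_neg hi, h2, pow_succ]
            field_simp
    · change g'.map (algebraMap ℂ K) * W * Pm = Pm * (g'.map (algebraMap ℂ K) * W)
      have hgP : g'.map (algebraMap ℂ K) * Pm = Pm * g'.map (algebraMap ℂ K) := by
        rw [hg'm, hPm, Matrix.diagonal_mul_diagonal, Matrix.diagonal_mul_diagonal]
        congr 1; funext i; ring
      rw [mul_assoc, ← hWP, ← mul_assoc, hgP, mul_assoc])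
  refine ⟨s, hs, ?_⟩
  set F := IntermediateField.adjoin ℂ (s : Set K) with hF
  have hu1 : IsUnit h1.det := isUnit_iff_ne_zero.2 hh1
  have hmulc : ∀ (L A B : Matrix (Fin n) (Fin n) K), L.det ≠ 0 →
      L * (A * B) * L⁻¹ = (L * A * L⁻¹) * (L * B * L⁻¹) := by
    intro L A B hL
    have := Matrix.nonsing_inv_mul L (isUnit_iff_ne_zero.2 hL)
    calc L * (A * B) * L⁻¹ = L * A * 1 * B * L⁻¹ := by simp only [mul_assoc, mul_one, one_mul]
      _ = _ := by rw [← this]; simp only [mul_assoc]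
  have hone : ∀ (L : Matrix (Fin n) (Fin n) K), L.det ≠ 0 → L * 1 * L⁻¹ = 1 := by
    intro L hL
    rw [mul_one, Matrix.mul_nonsing_inv _ (isUnit_iff_ne_zero.2 hL)]
  have eJ' : H * Jm * H⁻¹ = h1 * Jm * h1⁻¹ := eJ
  have eP' : H * Pm * H⁻¹ = h1 * Pm * h1⁻¹ := eP
  have hcomb : ∀ (L A B : Matrix (Fin n) (Fin n) K), L.det ≠ 0 →
      L * (Pm * A + (1 - Pm) * B) * L⁻¹ =
        (L * Pm * L⁻¹) * (L * A * L⁻¹) + (1 - L * Pm * L⁻¹) * (L * B * L⁻¹) := by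
    intro L A B hL
    rw [mul_add, add_mul, hmulc L _ _ hL, hmulc L _ _ hL, mul_sub, sub_mul, hone L hL]
  have eX : X = h1 * (Pm * Jm + (1 - Pm) * W1) * h1⁻¹ := by
    rw [hconj X]
    change H * (LinearMap.toMatrix b b x) * H⁻¹ = _
    rw [hX', hcomb _ _ _ hHdet, hcomb _ _ _ hh1, eJ', eP', eW]
  have eY : Y = h1 * (Pm * W1 + (1 - Pm) * Jm) * h1⁻¹ := by
    rw [hconj Y]
    change H * (LinearMap.toMatrix b b y) * H⁻¹ = _
    rw [hY', hcomb _ _ _ hHdet, hcomb _ _ _ hh1, eJ', eP', eW]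
  have f1 : ∀ i j, Pm i j ∈ F := entries_map F P
  have f2 : ∀ i j, Jm i j ∈ F := entries_map F J
  have f3 : ∀ i j, (1 - Pm) i j ∈ F := by
    intro i j
    rw [Matrix.sub_apply, Matrix.one_apply]
    apply sub_mem _ (f1 i j)
    split_ifs
    · exact one_mem _
    · exact zero_mem _
  have f4 := entries_inv F hF1 hh1
  intro i j
  constructor
  · rw [eX]
    exact entries_mul F (entries_mul F hF1 (fun i j => add_mem (entries_mul F f1 f2 i j) (entries_mul F f3 hF2 i j))) f4 i j
  · rw [eY]
    exact entries_mul F (entries_mul F hF1 (fun i j => add_mem (entries_mul F f1 hF2 i j) (entries_mul F f3 f2 i j))) f4 i j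

/-- STATEMENT 6: if `q ≠ 0` is not a root of unity, the scheme of `n`-dimensional
representations of `ℂ_q[x,y]`, i.e. the zero scheme of the entries of `X·Y − q·Y·X`,
has Krull dimension `n²`. -/
theorem stmt_6 (n : ℕ) (hn : 1 ≤ n) (q : ℂ) (hq : q ≠ 0)
    (hq' : ∀ k : ℕ, 1 ≤ k → q ^ k ≠ 1) :
    ringKrullDim
      (MvPolynomial ((Fin n × Fin n) ⊕ (Fin n × Fin n)) ℂ ⧸
        Ideal.span (Set.range fun p : Fin n × Fin n =>
          (genX n * genY n - (MvPolynomial.C q : MvPolynomial ((Fin n × Fin n) ⊕ (Fin n × Fin n)) ℂ) • (genY n * genX n)) p.1 p.2)) = (n ^ 2 : ℕ) := by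
  set I := Ideal.span (Set.range fun p : Fin n × Fin n =>
          (genX n * genY n - (MvPolynomial.C q : MvPolynomial ((Fin n × Fin n) ⊕ (Fin n × Fin n)) ℂ) • (genY n * genX n)) p.1 p.2) with hI
  let ψ : MvPolynomial ((Fin n × Fin n) ⊕ (Fin n × Fin n)) ℂ →ₐ[ℂ] MvPolynomial (Fin n × Fin n) ℂ :=
    MvPolynomial.aeval (Sum.elim MvPolynomial.X (fun _ => 0))
  have hψ : ∀ a ∈ I, ψ a = 0 := by
    intro a ha
    have : I ≤ RingHom.ker ψ.toRingHom := by
      rw [hI, Ideal.span_le]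
      rintro _ ⟨p, rfl⟩
      simp [RingHom.mem_ker, ψ, Matrix.mul_apply, genX, genY]
    exact this ha
  let ψ' : (MvPolynomial ((Fin n × Fin n) ⊕ (Fin n × Fin n)) ℂ ⧸ I) →ₐ[ℂ] MvPolynomial (Fin n × Fin n) ℂ :=
    Ideal.Quotient.liftₐ I ψ hψ
  have hsurj : Function.Surjective ψ' := by
    rw [← AlgHom.range_eq_top, eq_top_iff, ← MvPolynomial.adjoin_range_X, Algebra.adjoin_le_iff]
    rintro _ ⟨p, rfl⟩
    refine ⟨Ideal.Quotient.mk I (MvPolynomial.X (Sum.inl p)), ?_⟩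
    change ψ (MvPolynomial.X (Sum.inl p)) = _
    simp [ψ]
  have : Nontrivial (MvPolynomial ((Fin n × Fin n) ⊕ (Fin n × Fin n)) ℂ ⧸ I) :=
    hsurj.nontrivial
  apply le_antisymm
  · apply krull_le
    intro K _ _ φ
    let π := φ.comp (Ideal.Quotient.mkₐ ℂ I)
    obtain ⟨s, hs, h⟩ := key_field n q hq hq' K
      ((genX n).map π) ((genY n).map π) (by
        ext i j
        have h1 : π ((genX n * genY n - (MvPolynomial.C q : MvPolynomial ((Fin n × Fin n) ⊕ (Fin n × Fin n)) ℂ) • (genY n * genX n)) i j) = 0 := by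
          have : Ideal.Quotient.mk I ((genX n * genY n - (MvPolynomial.C q : MvPolynomial ((Fin n × Fin n) ⊕ (Fin n × Fin n)) ℂ) • (genY n * genX n)) i j) = 0 := by
            rw [Ideal.Quotient.eq_zero_iff_mem]
            exact Ideal.subset_span ⟨(i, j), rfl⟩
          change φ (Ideal.Quotient.mk I _) = 0
          rw [this, map_zero]
        have h2 : π (MvPolynomial.C q) = algebraMap ℂ K q := by
          rw [← MvPolynomial.algebraMap_eq]; exact π.commutes q
        rw [Matrix.sub_apply, Matrix.smul_apply, smul_eq_mul, map_sub, map_mul, h2, sub_eq_zero] at h1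
        rw [← Matrix.map_mul, ← Matrix.map_mul]
        exact h1)
    refine ⟨s, hs, fun r => ?_⟩
    obtain ⟨r, rfl⟩ := Ideal.Quotient.mk_surjective r
    change π r ∈ _
    have : Algebra.adjoin ℂ (Set.range (MvPolynomial.X : _ → MvPolynomial ((Fin n × Fin n) ⊕ (Fin n × Fin n)) ℂ)) ≤
      (IntermediateField.adjoin ℂ (s : Set K)).toSubalgebra.comap π := by
      rw [Algebra.adjoin_le_iff]
      rintro _ ⟨p | p, rfl⟩
      · exact (h p.1 p.2).1
      · exact (h p.1 p.2).2
    rw [MvPolynomial.adjoin_range_X] at this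
    exact this (Algebra.mem_top (x := r))
  · have := ringKrullDim_le_of_surjective ψ'.toRingHom hsurj
    rw [MvPolynomial.ringKrullDim_of_isNoetherianRing] at this
    simpa [pow_two] using this
end

section
/- Let q ∈ ℂ be a root of unity and let m ≥ 1 be its multiplicative order. Then for every n ≥ m, with S the polynomial ring over ℂ in the variables x_{ij}, y_{ij} (1 ≤ i, j ≤ n), X, Y the generic n×n matrices, and I ⊆ S the ideal generated by the entries of X·Y − q·Y·X, the Krull dimension of S/I is strictly greater than n². -/
open MvPolynomial

theorem aux_dim_integral {R S : Type*} [CommRing R] [CommRing S] [Algebra R S]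
    [Algebra.IsIntegral R S] [FaithfulSMul R S] : ringKrullDim R ≤ ringKrullDim S := by
  unfold ringKrullDim Order.krullDim
  refine iSup_le fun l => ?_
  obtain ⟨P, hP⟩ := Algebra.IsIntegral.comap_surjective R S (RelSeries.head l)
  have lo : P.asIdeal.LiesOver (RelSeries.head l).asIdeal := ⟨by rw [← hP]; rfl⟩
  obtain ⟨L, hL, -⟩ := Ideal.exists_ltSeries_of_hasGoingUp l P.asIdeal
  rw [← hL]
  exact le_iSup (fun p : LTSeries (PrimeSpectrum S) => ((p.length : ℕ∞) : WithBot ℕ∞)) L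

theorem aux_dim_trdeg {A : Type} [CommRing A] [IsDomain A] [Algebra ℂ A]
    [Algebra.FiniteType ℂ A] (N : ℕ) (hN : (N : Cardinal) ≤ Algebra.trdeg ℂ A) :
    (N : WithBot ℕ∞) ≤ ringKrullDim A := by
  obtain ⟨s, g, hg, hgint⟩ := exists_integral_inj_algHom_of_fg ℂ A
  let := g.toRingHom.toAlgebra
  have : IsScalarTower ℂ (MvPolynomial (Fin s) ℂ) A :=
    IsScalarTower.of_algebraMap_eq fun x => (g.commutes x).symm
  have : Algebra.IsIntegral (MvPolynomial (Fin s) ℂ) A := ⟨hgint⟩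
  have : FaithfulSMul (MvPolynomial (Fin s) ℂ) A :=
    (faithfulSMul_iff_algebraMap_injective _ _).mpr hg
  have h1 := _root_.trdeg_add_eq ℂ (MvPolynomial (Fin s) ℂ) (A := A)
  rw [_root_.trdeg_eq_zero (R := MvPolynomial (Fin s) ℂ) (A := A), add_zero, MvPolynomial.trdeg_of_isDomain] at h1
  rw [← h1] at hN
  have hs : N ≤ s := by simpa using hN
  refine le_trans ?_ (aux_dim_integral (R := MvPolynomial (Fin s) ℂ) (S := A))
  rw [MvPolynomial.ringKrullDim_of_isNoetherianRing, ringKrullDim_eq_zero_of_field]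
  simpa using hs

theorem aux_trdeg {σ : Type} [Finite σ] (A : Subalgebra ℂ (FractionRing (MvPolynomial σ ℂ)))
    (h : ∀ i : σ, IsAlgebraic A (algebraMap (MvPolynomial σ ℂ)
      (FractionRing (MvPolynomial σ ℂ)) (X i))) :
    (Nat.card σ : Cardinal) ≤ Algebra.trdeg ℂ A := by
  set K := FractionRing (MvPolynomial σ ℂ)
  have hp : ∀ p : MvPolynomial σ ℂ, IsAlgebraic A (algebraMap _ K p) := by
    intro p
    induction p using MvPolynomial.induction_on with
    | C a =>
      have : algebraMap (MvPolynomial σ ℂ) K (C a) = algebraMap A K (algebraMap ℂ A a) := by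
        rw [← IsScalarTower.algebraMap_apply ℂ A K,
          IsScalarTower.algebraMap_apply ℂ (MvPolynomial σ ℂ) K]; rfl
      rw [this]
      exact isAlgebraic_algebraMap _
    | add p q hp hq => rw [map_add]; exact hp.add hq
    | mul_X p i hp => rw [map_mul]; exact hp.mul (h i)
  have : Algebra.IsAlgebraic A K := ⟨fun x => by
    obtain ⟨p, r, -, rfl⟩ := IsFractionRing.div_surjective (A := MvPolynomial σ ℂ) x
    rw [div_eq_mul_inv]
    exact (hp p).mul (hp r).inv⟩
  have : FaithfulSMul ℂ A :=
    (faithfulSMul_iff_algebraMap_injective _ _).mpr (algebraMap ℂ A).injective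
  have h1 := _root_.trdeg_add_eq ℂ A (A := K)
  rw [_root_.trdeg_eq_zero (R := A) (A := K), add_zero] at h1
  rw [h1]
  have h2 := _root_.trdeg_add_eq ℂ (MvPolynomial σ ℂ) (A := K)
  rw [← h2, MvPolynomial.trdeg_of_isDomain]
  refine le_trans ?_ (self_le_add_right _ _)
  have := Fintype.ofFinite σ
  simp

theorem aux_eigvec {K : Type*} [Field K] {n : ℕ} (F : Subfield K)
    (X V : Matrix (Fin n) (Fin n) K) (d : Fin n → K) (hV : V.det ≠ 0)
    (hXV : X * V = V * Matrix.diagonal d)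
    (hX : ∀ i j, X i j ∈ F) (j : Fin n) (hd : d j ∈ F) (hVj : V j j = 1)
    (hne : ∀ i, i ≠ j → d i ≠ d j) (i : Fin n) : V i j ∈ F := by
  let X0 : Matrix (Fin n) (Fin n) F := Matrix.of fun i j => ⟨X i j, hX i j⟩
  let M0 : Matrix (Fin n) (Fin n) F := X0 - Matrix.diagonal (fun _ => ⟨d j, hd⟩)
  have hM : F.subtype.mapMatrix M0 = X - Matrix.diagonal (fun _ => d j) := by
    ext a b
    by_cases h : a = b <;> simp [M0, X0, h]
  have hu : IsUnit V.det := isUnit_iff_ne_zero.mpr hV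
  have hcomm : (X - Matrix.diagonal (fun _ => d j)) * V
      = V * Matrix.diagonal (fun i => d i - d j) := by
    rw [sub_mul, hXV, ← Matrix.diagonal_sub, mul_sub]
    congr 1
    ext a b
    simp [mul_comm]
  have hdet : M0.det = 0 := by
    have h1 : ((X - Matrix.diagonal (fun _ => d j)) * V).det = 0 := by
      rw [hcomm, Matrix.det_mul, Matrix.det_diagonal,
        Finset.prod_eq_zero (Finset.mem_univ j) (sub_self _), mul_zero]
    rw [Matrix.det_mul] at h1
    have h2 := (mul_eq_zero.mp h1).resolve_right hV
    rw [← hM, ← RingHom.map_det] at h2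
    simpa using h2
  obtain ⟨w, hw0, hw⟩ := Matrix.exists_mulVec_eq_zero_iff.mpr hdet
  let w' : Fin n → K := fun i => (w i : K)
  have hw' : (X - Matrix.diagonal (fun _ => d j)).mulVec w' = 0 := by
    rw [← hM]
    ext a
    have := congrArg (fun x : F => (x : K)) (congrFun hw a)
    simpa [Matrix.mulVec, dotProduct, w'] using this
  let u := V⁻¹.mulVec w'
  have hwu : w' = V.mulVec u := by
    simp [u, Matrix.mulVec_mulVec, Matrix.mul_nonsing_inv _ hu]
  have hDu : (Matrix.diagonal (fun i => d i - d j)).mulVec u = 0 := by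
    have : V.mulVec ((Matrix.diagonal (fun i => d i - d j)).mulVec u) = 0 := by
      rw [Matrix.mulVec_mulVec, ← hcomm, ← Matrix.mulVec_mulVec, ← hwu, hw']
    exact Matrix.eq_zero_of_mulVec_eq_zero hV this
  have hu0 : ∀ i, i ≠ j → u i = 0 := by
    intro i hi
    have := congrFun hDu i
    rw [Matrix.mulVec_diagonal] at this
    exact (mul_eq_zero.mp this).resolve_left (sub_ne_zero.mpr (hne i hi))
  have hwi : ∀ i, w' i = V i j * u j := by
    intro i
    rw [hwu]
    simp only [Matrix.mulVec, dotProduct]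
    exact Finset.sum_eq_single j (fun b _ hb => by rw [hu0 b hb, mul_zero]) (by simp)
  have huj : u j = w' j := by rw [hwi j, hVj, one_mul]
  have hujne : u j ≠ 0 := by
    intro h
    apply hw0
    ext i
    have := hwi i
    rw [h, mul_zero] at this
    simpa [w'] using this
  have : V i j = w' i / w' j := by
    rw [← huj, hwi i, mul_div_cancel_right₀ _ hujne]
  rw [this]
  exact F.div_mem (w i).2 (w j).2

theorem aux_eigval {K : Type*} [Field K] {n : ℕ} (A : Subring K)
    (X V : Matrix (Fin n) (Fin n) K) (d : Fin n → K) (hV : V.det ≠ 0)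
    (hXV : X * V = V * Matrix.diagonal d)
    (hX : ∀ i j, X i j ∈ A) (j : Fin n) : IsIntegral A (d j) := by
  let X0 : Matrix (Fin n) (Fin n) A := Matrix.of fun i j => ⟨X i j, hX i j⟩
  have hM : X0.map (algebraMap A K) = X := by
    ext a b; rfl
  refine ⟨X0.charpoly, X0.charpoly_monic, ?_⟩
  rw [← Polynomial.eval_map, ← Matrix.charpoly_map, hM, Matrix.eval_charpoly]
  have h1 : ((Matrix.scalar (Fin n) (d j) - X) * V).det = 0 := by
    have : (Matrix.scalar (Fin n) (d j) - X) * V = V * Matrix.diagonal (fun i => d j - d i) := by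
      rw [sub_mul, hXV, ← Matrix.diagonal_sub, mul_sub]
      congr 1
      ext a b
      simp [mul_comm]
    rw [this, Matrix.det_mul, Matrix.det_diagonal,
        Finset.prod_eq_zero (Finset.mem_univ j) (sub_self _), mul_zero]
  rw [Matrix.det_mul] at h1
  exact (mul_eq_zero.mp h1).resolve_right hV

/-- Matrix of (normalised) eigenvectors. -/
def auxV {K : Type*} [CommRing K] (m n : ℕ) (z : Option (Fin n × Fin n) → K) :
    Matrix (Fin n) (Fin n) K :=
  Matrix.of fun i j => if i = j ∧ (j.val = 0 ∨ m ≤ j.val) then 1 else z (some (i, j))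

/-- Eigenvalues of `X`. -/
def auxD {K : Type*} [CommRing K] (m n : ℕ) (hn : 0 < n) (q : K)
    (z : Option (Fin n × Fin n) → K) (j : Fin n) : K :=
  if m ≤ j.val then z (some (j, j)) else q ^ j.val * z (some (⟨0, hn⟩, ⟨0, hn⟩))

/-- The matrix of `Y` in the eigenbasis. -/
def auxE {K : Type*} [CommRing K] (m n : ℕ) (z : Option (Fin n × Fin n) → K) :
    Matrix (Fin n) (Fin n) K :=
  Matrix.of fun i j => if j.val < m ∧ i.val = (j.val + 1) % m then
    (if j.val + 1 = m then z none else 1) else 0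

theorem aux_map {K L : Type*} [CommRing K] [CommRing L] (f : K →+* L) (m n : ℕ)
    (z : Option (Fin n × Fin n) → K) :
    f.mapMatrix (auxV m n z) = auxV m n (fun s => f (z s)) := by
  ext i j
  simp only [auxV, RingHom.mapMatrix_apply, Matrix.map_apply, Matrix.of_apply]
  split_ifs <;> simp

theorem aux_det (m n : ℕ) :
    (auxV m n (fun s => (MvPolynomial.X s : MvPolynomial (Option (Fin n × Fin n)) ℂ))).det ≠ 0 := by
  intro h
  let y : Option (Fin n × Fin n) → ℂ := fun s => s.elim 0 fun p => if p.1 = p.2 then 1 else 0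
  have h1 : auxV m n y = 1 := by
    ext i j
    simp only [auxV, Matrix.of_apply, Matrix.one_apply, y, Option.elim]
    split_ifs <;> simp_all
  have h2 := congrArg (MvPolynomial.eval y) h
  rw [RingHom.map_det, aux_map] at h2
  simp only [MvPolynomial.eval_X] at h2
  have h3 : (auxV m n y).det = 0 := h2.trans (map_zero _)
  rw [h1, Matrix.det_one] at h3
  exact one_ne_zero h3

theorem aux_smul {K L : Type*} [CommRing K] [CommRing L] (f : K →+* L) {n : ℕ} (c : K) (c' : L)
    (hc : f c = c') (M : Matrix (Fin n) (Fin n) K) :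
    f.mapMatrix (c • M) = c' • f.mapMatrix M := by
  ext i j
  simp [← hc]

theorem aux_rel {K : Type*} [CommRing K] (m n : ℕ) (hm : 1 ≤ m) (hn : 0 < n) (q : K)
    (hq : q ^ m = 1) (z : Option (Fin n × Fin n) → K) :
    Matrix.diagonal (auxD m n hn q z) * auxE m n z =
      q • (auxE m n z * Matrix.diagonal (auxD m n hn q z)) := by
  ext i j
  rw [Matrix.diagonal_mul, Matrix.smul_apply, Matrix.mul_diagonal, smul_eq_mul]
  by_cases h : j.val < m ∧ i.val = (j.val + 1) % m
  · obtain ⟨h1, h2⟩ := h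
    have hi : i.val < m := h2 ▸ Nat.mod_lt _ hm
    have hqi : q ^ i.val = q * q ^ j.val := by
      rw [h2, ← pow_succ']
      conv_rhs => rw [← Nat.mod_add_div (j.val + 1) m, pow_add, pow_mul, hq, one_pow, mul_one]
    simp only [auxD, not_le.mpr hi, not_le.mpr h1, if_false, hqi]
    ring
  · simp [auxE, h]

theorem aux_conj {K : Type*} [Field K] {n : ℕ} (q : K) (V D E : Matrix (Fin n) (Fin n) K)
    (hV : V.det ≠ 0) (h : D * E = q • (E * D)) :
    (V * D * V⁻¹) * (V * E * V⁻¹) = q • ((V * E * V⁻¹) * (V * D * V⁻¹)) := by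
  have hu : IsUnit V.det := isUnit_iff_ne_zero.mpr hV
  have key : ∀ A B : Matrix (Fin n) (Fin n) K,
      (V * A * V⁻¹) * (V * B * V⁻¹) = V * (A * B) * V⁻¹ := by
    intro A B
    calc _ = V * A * (V⁻¹ * V) * B * V⁻¹ := by simp only [mul_assoc]
      _ = _ := by rw [Matrix.nonsing_inv_mul _ hu, mul_one]; simp only [mul_assoc]
  rw [key, key, h, Matrix.mul_smul, Matrix.smul_mul]

theorem aux_recover {K : Type*} [Field K] (m n : ℕ) (hm : 1 ≤ m) (hn : 0 < n) (hmn : m ≤ n)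
    (q : K) (z : Option (Fin n × Fin n) → K) (F : Subfield K)
    (X Y : Matrix (Fin n) (Fin n) K)
    (hV : (auxV m n z).det ≠ 0)
    (hXV : X * auxV m n z = auxV m n z * Matrix.diagonal (auxD m n hn q z))
    (hYV : Y * auxV m n z = auxV m n z * auxE m n z)
    (hX : ∀ i j, X i j ∈ F) (hY : ∀ i j, Y i j ∈ F)
    (hd : ∀ j, auxD m n hn q z j ∈ F)
    (hne : ∀ j : Fin n, (j.val = 0 ∨ m ≤ j.val) → ∀ i, i ≠ j →
      auxD m n hn q z i ≠ auxD m n hn q z j) (s : Option (Fin n × Fin n)) : z s ∈ F := by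
  have hsp : ∀ j : Fin n, (j.val = 0 ∨ m ≤ j.val) → ∀ i, auxV m n z i j ∈ F := by
    intro j hj i
    exact aux_eigvec F X _ _ hV hXV hX j (hd j) (by simp [auxV, hj]) (hne j hj) i
  -- action of Y on the columns
  have hcol : ∀ i j k : Fin n, j.val < m → k.val = (j.val + 1) % m →
      (Y * auxV m n z) i j = auxV m n z i k * (if j.val + 1 = m then z none else 1) := by
    intro i j k hj hk
    rw [hYV, Matrix.mul_apply, Finset.sum_eq_single k]
    · simp [auxE, hj, hk]
    · intro b _ hb
      have : ¬ (j.val < m ∧ b.val = (j.val + 1) % m) := by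
        rintro ⟨-, h⟩
        exact hb (Fin.ext (h.trans hk.symm))
      simp [auxE, this]
    · simp
  have hYmem : ∀ i j : Fin n, (∀ a, auxV m n z a j ∈ F) → (Y * auxV m n z) i j ∈ F := by
    intro i j h
    rw [Matrix.mul_apply]
    exact F.sum_mem fun a _ => F.mul_mem (hY _ _) (h a)
  have hlow : ∀ k : ℕ, ∀ hk : k < n, k < m → ∀ i, auxV m n z i ⟨k, hk⟩ ∈ F := by
    intro k
    induction k with
    | zero => intro hk _ i; exact hsp _ (Or.inl rfl) i
    | succ k ih =>
      intro hk hkm i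
      have h1 := hYmem i ⟨k, by omega⟩ (ih (by omega) (by omega))
      rw [hcol i ⟨k, by omega⟩ ⟨k + 1, hk⟩ (by simp; omega)
        (by simp [Nat.mod_eq_of_lt hkm])] at h1
      simpa [show k + 1 ≠ m by omega] using h1
  have hall : ∀ i j, auxV m n z i j ∈ F := by
    intro i j
    by_cases h : m ≤ j.val
    · exact hsp j (Or.inr h) i
    · exact hlow j.val j.2 (by omega) i
  rcases s with _ | ⟨i, j⟩
  · have h1 := hYmem ⟨0, hn⟩ ⟨m - 1, by omega⟩ (fun a => hall _ _)
    rw [hcol _ _ ⟨0, hn⟩ (by simp; omega) (by simp [Nat.sub_add_cancel hm])] at h1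
    simpa [auxV, Nat.sub_add_cancel hm] using h1
  · by_cases h : i = j ∧ (j.val = 0 ∨ m ≤ j.val)
    · obtain ⟨rfl, h⟩ := h
      have h1 := hd i
      rcases h with h | h
      · have : i = ⟨0, hn⟩ := Fin.ext h
        subst this
        simpa [auxD, show ¬ (m ≤ 0) by omega] using h1
      · simpa [auxD, h] using h1
    · have h1 := hall i j
      simpa [auxV, h] using h1

set_option maxHeartbeats 1000000 in
/-- STATEMENT 7: if `q` is a root of unity of multiplicative order `m ≥ 1`, then for every
`n ≥ m` the representation scheme of `ℂ_q[x,y]` in dimension `n` has Krull dimension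
strictly greater than `n²`. -/
theorem stmt_7 (q : ℂ) (m : ℕ) (hm : 1 ≤ m) (hq : q ^ m = 1)
    (hmin : ∀ k : ℕ, 1 ≤ k → q ^ k = 1 → m ≤ k) (n : ℕ) (hn : m ≤ n) :
    (n ^ 2 : ℕ) <
      ringKrullDim
        (MvPolynomial ((Fin n × Fin n) ⊕ (Fin n × Fin n)) ℂ ⧸
          Ideal.span (Set.range fun p : Fin n × Fin n =>
            (genX n * genY n -
              (MvPolynomial.C q : MvPolynomial ((Fin n × Fin n) ⊕ (Fin n × Fin n)) ℂ) •
                (genY n * genX n)) p.1 p.2)) := by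
  have hn0 : 0 < n := by omega
  let R := MvPolynomial (Option (Fin n × Fin n)) ℂ
  let K := FractionRing R
  let z0 : Option (Fin n × Fin n) → R := fun s => MvPolynomial.X s
  let z : Option (Fin n × Fin n) → K := fun s => algebraMap R K (z0 s)
  let qK : K := algebraMap ℂ K q
  have hinj : Function.Injective (algebraMap R K) := IsFractionRing.injective R K
  have hqK : qK ^ m = 1 := by simp only [qK, ← map_pow, hq, map_one]
  -- nonvanishing determinant
  have hV : (auxV m n z).det ≠ 0 := by
    have h1 : auxV m n z = (algebraMap R K).mapMatrix (auxV m n z0) :=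
      (aux_map (algebraMap R K) m n z0).symm
    rw [h1, ← RingHom.map_det]
    intro h2
    have h3 : (auxV m n z0).det = 0 := hinj (by rw [h2, map_zero])
    exact aux_det m n h3
  have hu : IsUnit (auxV m n z).det := isUnit_iff_ne_zero.mpr hV
  -- distinctness of eigenvalues
  have hdmap : ∀ j, auxD m n hn0 qK z j = algebraMap R K (auxD m n hn0 (MvPolynomial.C q) z0 j) := by
    intro j
    have : qK = algebraMap R K (MvPolynomial.C q) :=
      IsScalarTower.algebraMap_apply ℂ R K q
    simp only [auxD, z, this]
    split_ifs <;> simp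
  have hne : ∀ j : Fin n, (j.val = 0 ∨ m ≤ j.val) → ∀ i, i ≠ j →
      auxD m n hn0 qK z i ≠ auxD m n hn0 qK z j := by
    intro j hj i hij h
    rw [hdmap, hdmap] at h
    have h := hinj h
    have hj' : auxD m n hn0 (MvPolynomial.C q) z0 j = z0 (some (j, j)) := by
      rcases hj with hj | hj
      · have : j = ⟨0, hn0⟩ := Fin.ext hj
        subst this
        simp [auxD, show ¬ (m ≤ 0) by omega]
      · simp [auxD, hj]
    rw [hj'] at h
    by_cases him : m ≤ i.val
    · have h1 := congrArg (MvPolynomial.eval fun s => if s = some (j, j) then (1 : ℂ) else 0) h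
      simp [auxD, him, z0, hij] at h1
    · by_cases hj0 : j.val = 0
      · have : j = ⟨0, hn0⟩ := Fin.ext hj0
        subst this
        have h1 := congrArg (MvPolynomial.eval fun s => (1 : ℂ)) h
        simp only [auxD, him, z0, if_false, map_mul, map_pow, MvPolynomial.eval_C,
          MvPolynomial.eval_X, mul_one] at h1
        have h2 : i.val ≠ 0 := fun h0 => hij (Fin.ext h0)
        have := hmin i.val (by omega) h1
        omega
      · have hne0 : (⟨0, hn0⟩ : Fin n) ≠ j := fun h0 => hj0 (by rw [← h0])
        have h1 := congrArg (MvPolynomial.eval fun s => if s = some (j, j) then (1 : ℂ) else 0) h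
        simp [auxD, him, z0, hne0] at h1
  -- the representation
  let D : Matrix (Fin n) (Fin n) K := Matrix.diagonal (auxD m n hn0 qK z)
  let XK : Matrix (Fin n) (Fin n) K := auxV m n z * D * (auxV m n z)⁻¹
  let YK : Matrix (Fin n) (Fin n) K := auxV m n z * auxE m n z * (auxV m n z)⁻¹
  have hXV : XK * auxV m n z = auxV m n z * D := by
    simp only [XK]
    rw [mul_assoc, Matrix.nonsing_inv_mul _ hu, mul_one]
  have hYV : YK * auxV m n z = auxV m n z * auxE m n z := by
    simp only [YK]
    rw [mul_assoc, Matrix.nonsing_inv_mul _ hu, mul_one]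
  have hXY : XK * YK = qK • (YK * XK) :=
    aux_conj qK _ _ _ hV (aux_rel m n hm hn0 qK hqK z)
  let φ : MvPolynomial ((Fin n × Fin n) ⊕ (Fin n × Fin n)) ℂ →ₐ[ℂ] K :=
    MvPolynomial.aeval (Sum.elim (fun p => XK p.1 p.2) (fun p => YK p.1 p.2))
  have hφX : φ.toRingHom.mapMatrix (genX n) = XK := by
    ext i j; simp [genX, φ]
  have hφY : φ.toRingHom.mapMatrix (genY n) = YK := by
    ext i j; simp [genY, φ]
  let A : Subalgebra ℂ K := φ.range
  have hXA : ∀ i j, XK i j ∈ A := fun i j =>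
    ⟨MvPolynomial.X (Sum.inl (i, j)), by simp [φ]⟩
  have hYA : ∀ i j, YK i j ∈ A := fun i j =>
    ⟨MvPolynomial.X (Sum.inr (i, j)), by simp [φ]⟩
  let F : Subfield K :=
    { (Subalgebra.algebraicClosure A K).toSubring with
      inv_mem' := fun x (hx : IsAlgebraic A x) => hx.inv }
  have hAF : ∀ x ∈ A, x ∈ F := fun x hx =>
    show IsAlgebraic A x from isAlgebraic_algebraMap (⟨x, hx⟩ : A)
  have hd : ∀ j, auxD m n hn0 qK z j ∈ F := fun j =>
    show IsAlgebraic A _ from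
      (aux_eigval A.toSubring XK _ _ hV hXV hXA j : IsIntegral A.toSubring _).isAlgebraic
  have halg : ∀ s, IsAlgebraic A (z s) := fun s =>
    aux_recover m n hm hn0 hn qK z F XK YK hV hXV hYV (fun i j => hAF _ (hXA i j))
      (fun i j => hAF _ (hYA i j)) hd hne s
  have htr := aux_trdeg A halg
  have hft : Algebra.FiniteType ℂ A :=
    Algebra.FiniteType.of_surjective φ.rangeRestrict φ.rangeRestrict_surjective
  have hdim := aux_dim_trdeg (A := A) _ htr
  have hcard : Nat.card (Option (Fin n × Fin n)) = n ^ 2 + 1 := by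
    simp [sq]
  rw [hcard] at hdim
  refine lt_of_lt_of_le ?_ (le_trans hdim ?_)
  · exact_mod_cast Nat.lt_succ_self _
  · refine ringKrullDim_le_of_surjective
      (Ideal.Quotient.lift _ φ.rangeRestrict.toRingHom ?_)
      (Ideal.Quotient.lift_surjective_of_surjective _ _ φ.rangeRestrict_surjective)
    intro a ha
    have hle : Ideal.span (Set.range fun p : Fin n × Fin n =>
            (genX n * genY n -
              (MvPolynomial.C q : MvPolynomial ((Fin n × Fin n) ⊕ (Fin n × Fin n)) ℂ) •
                (genY n * genX n)) p.1 p.2) ≤ RingHom.ker φ.toRingHom := by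
      rw [Ideal.span_le]
      rintro _ ⟨p, rfl⟩
      have h1 : φ.toRingHom.mapMatrix (genX n * genY n -
              (MvPolynomial.C q : MvPolynomial ((Fin n × Fin n) ⊕ (Fin n × Fin n)) ℂ) •
                (genY n * genX n)) = 0 := by
        have h2 : ∀ M : Matrix (Fin n) (Fin n) _, φ.toRingHom.mapMatrix
            ((MvPolynomial.C q : MvPolynomial ((Fin n × Fin n) ⊕ (Fin n × Fin n)) ℂ) • M)
              = qK • φ.toRingHom.mapMatrix M := by
          intro M
          exact aux_smul φ.toRingHom _ qK (φ.commutes q) M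
        rw [map_sub, h2, map_mul, map_mul, hφX, hφY, hXY, sub_self]
      exact congrFun (congrFun h1 p.1) p.2
    have h3 : φ a = 0 := hle ha
    exact Subtype.ext h3
end

section
/- Fix n ≥ 1 and k ≥ 1. Consider the algebra P of polynomial functions on k-tuples of n×n complex matrices, i.e. the ℂ-subalgebra of all functions (M_n(ℂ))^k → ℂ consisting of those functions that are polynomial in the matrix entries. Let P^{GL} ⊆ P be the subalgebra of functions invariant under simultaneous conjugation: f(g A₁ g⁻¹, …, g A_k g⁻¹) = f(A₁, …, A_k) for all g ∈ GL_n(ℂ) and all (A₁,…,A_k). Then P^{GL} is generated, as a ℂ-algebra, by the trace functions T_w : (A₁,…,A_k) ↦ Tr(A_{w(1)} A_{w(2)} ⋯ A_{w(m)}), ranging over all nonempty words w = (w(1),…,w(m)) with letters in {1,…,k}. -/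
noncomputable section

variable (n k : ℕ)

/-- The algebra of polynomial functions on `k`-tuples of `n×n` complex matrices: the image of
the evaluation map from the polynomial ring in the matrix-entry variables. -/
def polyFns (n k : ℕ) :
    Subalgebra ℂ ((Fin k → Matrix (Fin n) (Fin n) ℂ) → ℂ) :=
  (MvPolynomial.aeval
    (R := ℂ) (fun v : Fin k × Fin n × Fin n => fun A : Fin k → Matrix (Fin n) (Fin n) ℂ =>
      A v.1 v.2.1 v.2.2)).range

/-- A function on `k`-tuples of matrices is invariant if it is unchanged under simultaneous
conjugation by any invertible matrix. -/
def IsConjInvariant (n k : ℕ) (f : (Fin k → Matrix (Fin n) (Fin n) ℂ) → ℂ) : Prop :=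
  ∀ g : GL (Fin n) ℂ, ∀ A : Fin k → Matrix (Fin n) (Fin n) ℂ,
    f (fun i => (g : Matrix (Fin n) (Fin n) ℂ) * A i * ((g⁻¹ : GL (Fin n) ℂ) :
      Matrix (Fin n) (Fin n) ℂ)) = f A

/-- The trace function of a word `w` in the letters `1,…,k`:
`(A₁,…,A_k) ↦ Tr(A_{w(1)} ⋯ A_{w(m)})`. -/
def traceFn (n k : ℕ) (w : List (Fin k)) :
    (Fin k → Matrix (Fin n) (Fin n) ℂ) → ℂ :=
  fun A => Matrix.trace (w.map A).prod

section Helpers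

open scoped BigOperators
open MvPolynomial

lemma exists_perm_of_sum_single {d : ℕ} {σ : Type*} (p q : Fin d → σ)
    (h : ∑ a, Finsupp.single (p a) 1 = ∑ a, Finsupp.single (q a) (1 : ℕ)) :
    ∃ s : Equiv.Perm (Fin d), q = p ∘ s := by
  classical
  have hc : ∀ v, Nonempty ({a // q a = v} ≃ {a // p a = v}) := by
    intro v
    have h1 := DFunLike.congr_fun h v
    simp only [Finsupp.finsetSum_apply, Finsupp.single_apply, Finset.sum_boole] at h1
    refine Fintype.card_eq.1 ?_
    rw [Fintype.card_subtype, Fintype.card_subtype]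
    exact_mod_cast h1.symm
  have e := fun v => (hc v).some
  refine ⟨(Equiv.sigmaFiberEquiv q).symm.trans
    ((Equiv.sigmaCongrRight e).trans (Equiv.sigmaFiberEquiv p)), ?_⟩
  funext a
  exact (((e (q a)) ⟨a, rfl⟩).2).symm

lemma prod_X_eq {d : ℕ} {σ : Type*} (p : Fin d → σ) (c : ℂ) :
    C c * ∏ a, (X (p a) : MvPolynomial σ ℂ) = monomial (∑ a, Finsupp.single (p a) 1) c := by
  rw [← mul_one c, ← C_mul_monomial, mul_one, monomial_sum_one]
  rfl

/-- Pairing of a vanishing combination of monomials with a symmetric tensor. -/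
lemma pairing {d : ℕ} {σ τ : Type*} [Fintype τ] (p : τ → Fin d → σ) (c : τ → ℂ)
    (S : (Fin d → σ) → ℂ) (hS : ∀ (s : Equiv.Perm (Fin d)) p, S (p ∘ s) = S p)
    (h : ∑ t, C (c t) * ∏ a, (X (p t a) : MvPolynomial σ ℂ) = 0) :
    ∑ t, c t * S (p t) = 0 := by
  classical
  simp only [prod_X_eq] at h
  set m : (Fin d → σ) → (σ →₀ ℕ) := fun p => ∑ a, Finsupp.single (p a) 1 with hm
  have hfac : ∃ φ : (σ →₀ ℕ) → ℂ, ∀ p, S p = φ (m p) := by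
    have : Function.FactorsThrough S m := by
      intro p q hpq
      obtain ⟨s, rfl⟩ := exists_perm_of_sum_single p q hpq
      exact (hS s p).symm
    exact ⟨Function.extend m S 0, fun p => (this.extend_apply 0 p).symm⟩
  obtain ⟨φ, hφ⟩ := hfac
  have := congrArg (fun P => (basisMonomials σ ℂ).constr ℂ φ P) h
  simp only [map_sum, map_zero] at this
  rw [← this]
  refine Finset.sum_congr rfl fun t _ => ?_
  have h2 : (monomial (m (p t))) (c t) = c t • (basisMonomials σ ℂ (m (p t))) := by
    simp [smul_monomial]
  change _ = (basisMonomials σ ℂ).constr ℂ φ ((monomial (m (p t))) (c t))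
  rw [h2, map_smul, Module.Basis.constr_basis, hφ, smul_eq_mul]

/-- A homogeneous polynomial comes from a symmetric tensor. -/
lemma sym_exists {d : ℕ} {σ : Type*} [Fintype σ] (P : MvPolynomial σ ℂ) (hP : P.IsHomogeneous d) :
    ∃ F : (Fin d → σ) → ℂ, (∀ (s : Equiv.Perm (Fin d)) p, F (p ∘ s) = F p) ∧
      ∀ A : σ → ℂ, eval A P = ∑ p, F p * ∏ a, A (p a) := by
  classical
  have hq : ∀ m : σ →₀ ℕ, m.degree = d → ∃ q : Fin d → σ, ∑ a, Finsupp.single (q a) 1 = m := by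
    intro m hm
    have hl : (Finsupp.toMultiset m).toList.length = d := by
      rw [Multiset.length_toList, Finsupp.card_toMultiset, ← hm]; rfl
    subst hl
    refine ⟨fun a => (Finsupp.toMultiset m).toList.get a, ?_⟩
    apply (Multiset.toFinsupp (α := σ)).symm.injective
    change Finsupp.toMultiset _ = Finsupp.toMultiset _
    rw [map_sum]
    simp only [Finsupp.toMultiset_single, one_smul]
    conv_rhs => rw [← Multiset.coe_toList (Finsupp.toMultiset m), ← Multiset.sum_map_singleton
      ((Finsupp.toMultiset m).toList : Multiset σ)]
    rw [Multiset.map_coe, Multiset.sum_coe, ← List.sum_ofFn]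
    congr 1
    apply List.ext_getElem <;> simp
  let F0 : (Fin d → σ) → ℂ := fun p => ∑ m ∈ P.support, if h : m.degree = d then
      if p = (hq m h).choose then P.coeff m else 0 else 0
  have hF0 : ∀ A : σ → ℂ, eval A P = ∑ p, F0 p * ∏ a, A (p a) := by
    intro A
    simp only [F0, Finset.sum_mul]
    rw [Finset.sum_comm]
    conv_lhs => rw [P.as_sum, map_sum]
    refine Finset.sum_congr rfl fun m hm => ?_
    have hd : m.degree = d := by
      by_contra hne
      exact (mem_support_iff.1 hm) (hP.coeff_eq_zero hne)
    have hs := (hq m hd).choose_spec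
    simp only [hd, dite_true, ite_mul, zero_mul, Finset.sum_ite_eq', Finset.mem_univ, if_true]
    conv_lhs => rw [← hs]
    rw [← prod_X_eq, map_mul, map_prod, eval_C, hs]
    simp
  refine ⟨fun p => (Fintype.card (Equiv.Perm (Fin d)) : ℂ)⁻¹ * ∑ s : Equiv.Perm (Fin d), F0 (p ∘ s),
    ?_, ?_⟩
  · intro s p
    refine congrArg (fun z : ℂ => (Fintype.card (Equiv.Perm (Fin d)) : ℂ)⁻¹ * z) ?_
    exact Fintype.sum_equiv (Equiv.mulLeft s) _ _ (fun t => rfl)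
  · intro A
    have h1 : ∀ s : Equiv.Perm (Fin d), ∑ p, F0 (p ∘ s) * ∏ a, A (p a) = eval A P := by
      intro s
      rw [hF0]
      refine Fintype.sum_equiv (s.symm.arrowCongr (Equiv.refl σ)) _ _ (fun p => ?_)
      have : ∏ a, A (p a) = ∏ a, A (p (s a)) :=
        (Fintype.prod_equiv s _ _ (fun a => rfl)).symm
      rw [this]
      rfl
    simp only [mul_assoc, Finset.sum_mul]
    rw [← Finset.mul_sum, Finset.sum_comm]
    simp only [h1]
    simp [Finset.card_univ]

lemma eq_zero_of_GL {n : ℕ} (P : MvPolynomial (Fin n × Fin n) ℂ)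
    (h : ∀ g : GL (Fin n) ℂ, eval (fun v => (g : Matrix (Fin n) (Fin n) ℂ) v.1 v.2) P = 0) :
    P = 0 := by
  have : P * (Matrix.mvPolynomialX (Fin n) (Fin n) ℂ).det = 0 := by
    apply MvPolynomial.funext
    intro x
    rw [map_mul, map_zero]
    by_cases hx : (Matrix.of fun i j => x (i, j)).det = 0
    · rw [RingHom.map_det]
      convert mul_zero _
      rw [← hx]
      congr 1
      ext i j
      simp
    · have := h (Matrix.GeneralLinearGroup.mkOfDetNeZero _ hx)
      have h2 : eval x P = 0 := this
      rw [h2, zero_mul]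
  exact (mul_eq_zero.1 this).resolve_right (Matrix.det_mvPolynomialX_ne_zero _ _)

lemma homComp_bind {σ τ : Type*} (ψ : σ → MvPolynomial τ ℂ) (hψ : ∀ v, (ψ v).IsHomogeneous 1)
    (d : ℕ) (P : MvPolynomial σ ℂ) :
    homogeneousComponent d (aeval ψ P) = aeval ψ (homogeneousComponent d P) := by
  conv_lhs => rw [← sum_homogeneousComponent P]
  rw [map_sum, map_sum]
  have : ∀ i, homogeneousComponent d (aeval ψ (homogeneousComponent i P)) =
      if d = i then aeval ψ (homogeneousComponent i P) else 0 := by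
    intro i
    apply homogeneousComponent_of_mem
    have := (homogeneousComponent_isHomogeneous i P).aeval ψ hψ
    rwa [one_mul] at this
  simp only [this]
  rw [Finset.sum_ite_eq]
  split_ifs with h
  · rfl
  · rw [homogeneousComponent_eq_zero, map_zero]
    simpa using h

/-- Double centralizer theorem for permutation representations. -/
lemma density {G ι : Type*} [Group G] [Fintype G] [Fintype ι] [DecidableEq ι] [MulAction G ι]
    (T : Matrix ι ι ℂ)
    (hT : ∀ S : Matrix ι ι ℂ, (∀ (g : G) i j, S (g • i) (g • j) = S i j) → T * S = S * T) :
    ∃ c : G → ℂ, ∀ i j, T i j = ∑ g, c g * if g • i = j then 1 else 0 := by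
  classical
  let Pm : G → Matrix ι ι ℂ := fun g => Matrix.of fun i j => if g • i = j then 1 else 0
  let W : Submodule ℂ (Matrix ι ι ℂ) := Submodule.span ℂ (Set.range Pm)
  have hPm : ∀ g h, (Pm h).submatrix (g • ·) id = Pm (h * g) := by
    intro g h
    ext i j
    simp [Pm, mul_smul]
  let L : G → Matrix ι ι ℂ →ₗ[ℂ] Matrix ι ι ℂ := fun g =>
    { toFun := fun X => X.submatrix (g • ·) id
      map_add' := fun _ _ => rfl
      map_smul' := fun _ _ => rfl }
  have hLa : ∀ g X i j, L g X i j = X (g • i) j := fun _ _ _ _ => rfl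
  have hL : ∀ g h X, L g (L h X) = L (h * g) X := by
    intro g h X
    ext i j
    simp [hLa, mul_smul]
  have hWL : ∀ g, ∀ X ∈ W, L g X ∈ W := by
    intro g X hX
    induction hX using Submodule.span_induction with
    | mem x hx =>
      obtain ⟨h, rfl⟩ := hx
      exact Submodule.subset_span ⟨h * g, (hPm g h).symm⟩
    | zero => simp
    | add x y _ _ hx hy => rw [map_add]; exact W.add_mem hx hy
    | smul a x _ hx => rw [map_smul]; exact W.smul_mem a hx
  obtain ⟨π, hπ⟩ := LinearMap.exists_extend (LinearMap.id : W →ₗ[ℂ] W)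
  have hπ' : ∀ X (hX : X ∈ W), (π X : Matrix ι ι ℂ) = X := by
    intro X hX
    have := LinearMap.congr_fun hπ ⟨X, hX⟩
    exact congrArg Subtype.val this
  let E : Matrix ι ι ℂ →ₗ[ℂ] Matrix ι ι ℂ := (Fintype.card G : ℂ)⁻¹ •
    ∑ g : G, (L g⁻¹) ∘ₗ W.subtype ∘ₗ π ∘ₗ (L g)
  have hE : ∀ X, E X = (Fintype.card G : ℂ)⁻¹ • ∑ g : G, L g⁻¹ (π (L g X) : Matrix ι ι ℂ) := by
    intro X
    simp [E, LinearMap.sum_apply]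
  have hEW : ∀ X, E X ∈ W := by
    intro X
    rw [hE]
    exact W.smul_mem _ (W.sum_mem fun g _ => hWL _ _ (π (L g X)).2)
  have hE1 : E 1 = 1 := by
    rw [hE]
    have h1 : (1 : Matrix ι ι ℂ) ∈ W := Submodule.subset_span ⟨1, by
      ext i j; simp [Pm, Matrix.one_apply]⟩
    have : ∀ g : G, L g⁻¹ (π (L g 1) : Matrix ι ι ℂ) = 1 := by
      intro g
      rw [hπ' _ (hWL g _ h1), hL]
      ext i j
      rw [hLa, mul_inv_cancel]
      exact congrArg (fun z => (1 : Matrix ι ι ℂ) z j) (one_smul G i)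
    simp only [this]
    rw [Finset.sum_const, ← Nat.cast_smul_eq_nsmul ℂ, smul_smul, Finset.card_univ,
      inv_mul_cancel₀ (by exact_mod_cast Fintype.card_ne_zero), one_smul]
  have hEL : ∀ g X, E (L g X) = L g (E X) := by
    intro g X
    rw [hE, hE, map_smul, map_sum]
    congr 1
    refine Fintype.sum_equiv (Equiv.mulLeft g) _ _ (fun h => ?_)
    simp only [hL, Equiv.coe_mulLeft]
    congr 2
    group
  -- entries of `E`
  let S : ι → ι → Matrix ι ι ℂ := fun c e => Matrix.of fun a b => E (Matrix.single b e 1) a c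
  have hS : ∀ c e (g : G) i j, S c e (g • i) (g • j) = S c e i j := by
    intro c e g i j
    have h1 : L g (Matrix.single (g • j) e 1) = Matrix.single j e 1 := by
      ext a b
      simp [hLa, Matrix.single_apply]
    have h2 := hEL g (Matrix.single (g • j) e 1)
    rw [h1] at h2
    simp only [S, Matrix.of_apply]
    rw [h2]
    rfl
  have hSE : ∀ X a c, E X a c = ∑ e, (S c e * X) a e := by
    intro X a c
    conv_lhs => rw [Matrix.matrix_eq_sum_single X]
    simp only [map_sum, Matrix.sum_apply, Matrix.mul_apply, S, Matrix.of_apply]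
    rw [Finset.sum_comm]
    refine Finset.sum_congr rfl fun e _ => Finset.sum_congr rfl fun b _ => ?_
    have : Matrix.single b e (X b e) = X b e • Matrix.single b e (1 : ℂ) := by
      simp [Matrix.smul_single]
    rw [this, map_smul, Matrix.smul_apply, smul_eq_mul, mul_comm]
  have hTE : E T = T := by
    ext a c
    rw [hSE]
    have h3 : ∀ e, S c e * T = T * S c e := fun e => (hT _ (hS c e)).symm
    simp only [h3]
    have h4 : ∀ b, ∑ e, S c e b e = (1 : Matrix ι ι ℂ) b c := by
      intro b
      rw [← hE1, hSE]
      simp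
    simp only [Matrix.mul_apply]
    rw [Finset.sum_comm]
    simp only [← Finset.mul_sum, h4]
    simp [Matrix.one_apply]
  have hTW : T ∈ W := hTE ▸ hEW T
  obtain ⟨c, hc⟩ := (Submodule.mem_span_range_iff_exists_fun ℂ).1 hTW
  refine ⟨c, fun i j => ?_⟩
  rw [← hc, Matrix.sum_apply]
  simp [Pm]

lemma trace_cycles_aux (n k : ℕ) (ι : Type) [Fintype ι] :
    ∀ (σ : Equiv.Perm ι) (w : ι → List (Fin k)), (∀ a, w a ≠ []) →
    (fun A : Fin k → Matrix (Fin n) (Fin n) ℂ =>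
      ∑ᶠ J : ι → Fin n, ∏ a, ((w a).map A).prod (J (σ a)) (J a)) ∈
    Algebra.adjoin ℂ {f | ∃ w : List (Fin k), w ≠ [] ∧ f = traceFn n k w} := by
  classical
  refine Fintype.induction_empty_option (P := fun ι _ => 
    ∀ (σ : Equiv.Perm ι) (w : ι → List (Fin k)), (∀ a, w a ≠ []) →
    (fun A : Fin k → Matrix (Fin n) (Fin n) ℂ =>
      ∑ᶠ J : ι → Fin n, ∏ a, ((w a).map A).prod (J (σ a)) (J a)) ∈
    Algebra.adjoin ℂ {f | ∃ w : List (Fin k), w ≠ [] ∧ f = traceFn n k w}) ?_ ?_ ?_ ι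
  · intro α β _ e ih σ w hw
    let _ : Fintype α := Fintype.ofEquiv β e.symm
    convert ih ((e.trans σ).trans e.symm) (w ∘ e) (fun a => hw _) using 2 with A
    rw [finsum_eq_sum_of_fintype, finsum_eq_sum_of_fintype]
    refine Fintype.sum_equiv (e.symm.arrowCongr (Equiv.refl _)) _ _ (fun J => ?_)
    refine (Fintype.prod_equiv e _ _ (fun a => ?_)).symm
    simp [Equiv.arrowCongr]
  · intro σ w hw
    convert Subalgebra.one_mem _ using 2 with A
    rw [finsum_eq_sum_of_fintype]
    simp
  · intro α _ ih σ w hw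
    simp only [finsum_eq_sum_of_fintype] at ih ⊢
    have key : ∀ A : Fin k → Matrix (Fin n) (Fin n) ℂ,
        ∑ J : Option α → Fin n, ∏ a, ((w a).map A).prod (J (σ a)) (J a) =
        ∑ J : α → Fin n, ∑ x : Fin n,
          ((w none).map A).prod ((σ none).elim x J) x *
            ∏ a, ((w (some a)).map A).prod ((σ (some a)).elim x J) (J a) := by
      intro A
      rw [Finset.sum_comm]
      refine Eq.trans ?_ (Fintype.sum_prod_type (fun y : Fin n × (α → Fin n) =>
        ((w none).map A).prod ((σ none).elim y.1 y.2) y.1 *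
            ∏ a, ((w (some a)).map A).prod ((σ (some a)).elim y.1 y.2) (y.2 a)))
      refine Fintype.sum_equiv Equiv.piOptionEquivProd _ _ (fun J => ?_)
      rw [Fintype.prod_option]
      have hJ : ∀ o, Option.elim o (J none) (fun a => J (some a)) = J o := by
        intro o; cases o <;> rfl
      simp only [Equiv.piOptionEquivProd_apply, hJ]
    simp only [key]
    by_cases h0 : σ none = none
    · have hs : ∀ a, σ (some a) = some (Equiv.removeNone σ a) := by
        intro a
        rw [Equiv.removeNone_some]
        rw [← Option.ne_none_iff_exists']
        intro h
        rw [← h0] at h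
        simpa using σ.injective h
      have := Subalgebra.mul_mem _ (Algebra.subset_adjoin
        (show traceFn n k (w none) ∈ {f | ∃ w : List (Fin k), w ≠ [] ∧ f = traceFn n k w} from
        ⟨w none, hw none, rfl⟩)) (ih (Equiv.removeNone σ) (fun a => w (some a)) (fun a => hw _))
      convert this using 1
      funext A
      simp only [h0, hs, Option.elim, Pi.mul_apply, traceFn, Matrix.trace, Matrix.diag]
      rw [Finset.sum_comm, Finset.sum_mul_sum]
    · obtain ⟨b, hb⟩ := Option.ne_none_iff_exists'.1 h0
      have hc0 : σ.symm none ≠ none := fun h => h0 (by rw [← h, Equiv.apply_symm_apply, h])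
      obtain ⟨c, hc⟩ := Option.ne_none_iff_exists'.1 hc0
      have hc' : σ (some c) = none := by rw [← hc, Equiv.apply_symm_apply]
      have hs : ∀ a, a ≠ c → σ (some a) = some (Equiv.removeNone σ a) := by
        intro a ha
        rw [Equiv.removeNone_some]
        rw [← Option.ne_none_iff_exists']
        intro h
        rw [← hc'] at h
        exact ha (by simpa using σ.injective h)
      have hcb : Equiv.removeNone σ c = b := by
        have := Equiv.removeNone_none σ hc'
        rw [hb] at this
        simpa using this
      convert ih (Equiv.removeNone σ)
        (Function.update (fun a => w (some a)) c (w none ++ w (some c))) (fun a => ?_) using 1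
      · funext A
        refine Finset.sum_congr rfl fun J _ => ?_
        rw [← Finset.mul_prod_erase Finset.univ _ (Finset.mem_univ c)]
        rw [Function.update_self, hcb, List.map_append, List.prod_append, Matrix.mul_apply,
          Finset.sum_mul]
        refine Finset.sum_congr rfl fun x _ => ?_
        rw [← Finset.mul_prod_erase Finset.univ _ (Finset.mem_univ c), hb, hc', mul_assoc]
        simp only [Option.elim]
        congr 2
        refine Finset.prod_congr rfl fun a ha => ?_
        have ha' := (Finset.mem_erase.1 ha).1
        rw [Function.update_of_ne ha', hs a ha']
      · by_cases h : a = c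
        · subst h; simp [hw]
        · rw [Function.update_of_ne h]; exact hw _

lemma trace_cycles (n k d : ℕ) (σ : Equiv.Perm (Fin d)) (w : Fin d → Fin k) :
    (fun A : Fin k → Matrix (Fin n) (Fin n) ℂ =>
      ∑ J : Fin d → Fin n, ∏ a, A (w a) (J (σ a)) (J a)) ∈
    Algebra.adjoin ℂ {f | ∃ w : List (Fin k), w ≠ [] ∧ f = traceFn n k w} := by
  have := trace_cycles_aux n k (Fin d) σ (fun a => [w a]) (fun a => by simp)
  simpa only [finsum_eq_sum_of_fintype, List.map_cons, List.map_nil, List.prod_singleton] using this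

lemma sym_zero {d : ℕ} {σ : Type*} [Fintype σ] (F : (Fin d → σ) → ℂ)
    (hF : ∀ (s : Equiv.Perm (Fin d)) p, F (p ∘ s) = F p)
    (h : ∀ A : σ → ℂ, ∑ p, F p * ∏ a, A (p a) = 0) (p : Fin d → σ) : F p = 0 := by
  classical
  have h1 : ∑ p : Fin d → σ, C (F p) * ∏ a, (X (p a) : MvPolynomial σ ℂ) = 0 := by
    apply MvPolynomial.funext
    intro A
    simp only [map_sum, map_mul, map_prod, eval_C, eval_X, map_zero]
    exact h A
  have h2 := pairing (fun p : Fin d → σ => p) F (fun p => star (F p))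
    (fun s p => by rw [hF]) h1
  have h3 : ∀ p, F p * star (F p) = ((Complex.normSq (F p) : ℝ) : ℂ) := fun p =>
    Complex.mul_conj _
  simp only [h3] at h2
  rw [← Complex.ofReal_sum, Complex.ofReal_eq_zero] at h2
  have h4 := (Finset.sum_eq_zero_iff_of_nonneg (fun p _ => Complex.normSq_nonneg _)).1 h2 p
    (Finset.mem_univ _)
  exact Complex.normSq_eq_zero.1 h4

lemma sum_triple {n k d : ℕ} (f : (Fin d → Fin k × Fin n × Fin n) → ℂ) :
    ∑ p, f p = ∑ w : Fin d → Fin k, ∑ I : Fin d → Fin n, ∑ J : Fin d → Fin n,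
      f (fun a => (w a, I a, J a)) := by
  rw [Fintype.sum_equiv (Equiv.arrowProdEquivProdArrow (Fin d) (fun _ => Fin k)
    (fun _ => Fin n × Fin n)) f (fun x => f (fun a => (x.1 a, x.2 a))) (fun p => rfl),
    Fintype.sum_prod_type]
  refine Finset.sum_congr rfl fun w _ => ?_
  change ∑ y : Fin d → Fin n × Fin n, f (fun a => (w a, y a)) = _
  rw [Fintype.sum_equiv (Equiv.arrowProdEquivProdArrow (Fin d) (fun _ => Fin n)
    (fun _ => Fin n)) (fun y => f (fun a => (w a, y a)))
    (fun x => f (fun a => (w a, x.1 a, x.2 a))) (fun p => rfl),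
    Fintype.sum_prod_type]

lemma core (n k d : ℕ) (P : MvPolynomial (Fin k × Fin n × Fin n) ℂ) (hP : P.IsHomogeneous d)
    (hinv : ∀ (g : GL (Fin n) ℂ) (A : Fin k → Matrix (Fin n) (Fin n) ℂ),
      eval (fun v => ((g : Matrix (Fin n) (Fin n) ℂ) * A v.1) v.2.1 v.2.2) P =
      eval (fun v => (A v.1 * (g : Matrix (Fin n) (Fin n) ℂ)) v.2.1 v.2.2) P) :
    (fun A : Fin k → Matrix (Fin n) (Fin n) ℂ => eval (fun v => A v.1 v.2.1 v.2.2) P) ∈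
    Algebra.adjoin ℂ {f | ∃ w : List (Fin k), w ≠ [] ∧ f = traceFn n k w} := by
  classical
  obtain ⟨F, hF, hFP⟩ := sym_exists P hP
  let Fw : (Fin d → Fin k) → (Fin d → Fin n) → (Fin d → Fin n) → ℂ :=
    fun w I J => F (fun a => (w a, I a, J a))
  have hFw : ∀ (s : Equiv.Perm (Fin d)) w I J, Fw (w ∘ s) (I ∘ s) (J ∘ s) = Fw w I J :=
    fun s w I J => hF s (fun a => (w a, I a, J a))
  have hsum : ∀ A : Fin k → Matrix (Fin n) (Fin n) ℂ, eval (fun v => A v.1 v.2.1 v.2.2) P =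
      ∑ w, ∑ I, ∑ J, Fw w I J * ∏ a, A (w a) (I a) (J a) := by
    intro A
    rw [hFP, sum_triple]
  have hcomm : ∀ (g : GL (Fin n) ℂ) w K J,
      ∑ I, Fw w I J * ∏ a, (g : Matrix (Fin n) (Fin n) ℂ) (I a) (K a) =
      ∑ I, Fw w K I * ∏ a, (g : Matrix (Fin n) (Fin n) ℂ) (J a) (I a) := by
    intro g
    set G : Matrix (Fin n) (Fin n) ℂ := (g : Matrix (Fin n) (Fin n) ℂ) with hG
    let D : (Fin d → Fin k × Fin n × Fin n) → ℂ := fun p =>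
      ∑ I, Fw (fun a => (p a).1) I (fun a => (p a).2.2) * ∏ a, G (I a) (p a).2.1 -
      ∑ I, Fw (fun a => (p a).1) (fun a => (p a).2.1) I * ∏ a, G (p a).2.2 (I a)
    have hD : ∀ p, D p = 0 := by
      apply sym_zero
      · intro s p
        simp only [D]
        congr 1
        · refine (Fintype.sum_equiv (s.symm.arrowCongr (Equiv.refl _)) _ _ (fun I => ?_)).symm
          rw [← hFw s]
          congr 1
          exact (Fintype.prod_equiv s _ _ (fun a => rfl)).symm
        · refine (Fintype.sum_equiv (s.symm.arrowCongr (Equiv.refl _)) _ _ (fun I => ?_)).symm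
          rw [← hFw s]
          congr 1
          exact (Fintype.prod_equiv s _ _ (fun a => rfl)).symm
      · intro A'
        let A : Fin k → Matrix (Fin n) (Fin n) ℂ := fun l => Matrix.of fun i j => A' (l, i, j)
        have h1 := hinv g A
        rw [hsum (fun l => G * A l), hsum (fun l => A l * G)] at h1
        simp only [Matrix.mul_apply, Finset.prod_univ_sum, Fintype.piFinset_univ,
          Finset.prod_mul_distrib] at h1
        rw [sum_triple]
        simp only [D, sub_mul, Finset.sum_sub_distrib]
        rw [sub_eq_zero]
        refine Eq.trans ?_ (h1.trans ?_)
        · refine Finset.sum_congr rfl fun w _ => ?_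
          simp only [Finset.sum_mul, Finset.mul_sum]
          rw [Finset.sum_comm]
          conv_rhs => rw [Finset.sum_comm]
          refine Finset.sum_congr rfl fun J _ => ?_
          rw [Finset.sum_comm]
          refine Finset.sum_congr rfl fun I _ => Finset.sum_congr rfl fun K _ => ?_
          rw [mul_assoc]; rfl
        · refine Finset.sum_congr rfl fun w _ => ?_
          simp only [Finset.sum_mul, Finset.mul_sum]
          refine Finset.sum_congr rfl fun I _ => ?_
          rw [Finset.sum_comm]
          refine Finset.sum_congr rfl fun K _ => Finset.sum_congr rfl fun J _ => ?_
          rw [mul_assoc, mul_comm (∏ a, G _ _)]; rfl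
    intro w K J
    exact sub_eq_zero.1 (hD (fun a => (w a, K a, J a)))
  letI act : MulAction (Equiv.Perm (Fin d)) (Fin d → Fin n) := arrowAction
  have hact : ∀ (s : Equiv.Perm (Fin d)) (I : Fin d → Fin n), s • I = I ∘ (s⁻¹ : Equiv.Perm (Fin d)) :=
    fun _ _ => rfl
  have hdens : ∀ w, ∃ c : Equiv.Perm (Fin d) → ℂ, ∀ I J : Fin d → Fin n,
      Fw w J I = ∑ s, c s * if s • I = J then 1 else 0 := by
    intro w
    refine density (G := Equiv.Perm (Fin d)) (Matrix.of fun I J => Fw w J I) (fun S hS => ?_)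
    ext J K
    simp only [Matrix.mul_apply, Matrix.of_apply]
    have h0 : ∑ t : (Fin d → Fin n) ⊕ (Fin d → Fin n),
        C (Sum.elim (fun I => Fw w I J) (fun I => - Fw w K I) t) *
        ∏ a, (X (Sum.elim (fun I a => (I a, K a)) (fun I a => (J a, I a)) t a) :
          MvPolynomial (Fin n × Fin n) ℂ) = 0 := by
      apply eq_zero_of_GL
      intro g
      rw [Fintype.sum_sum_type]
      simp only [map_add, map_sum, map_mul, map_prod, eval_C, eval_X, Sum.elim_inl, Sum.elim_inr,
        neg_mul, Finset.sum_neg_distrib]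
      rw [hcomm g w K J, add_neg_cancel]
    have h1 := pairing _ _ (fun p => S (fun a => (p a).1) (fun a => (p a).2))
      (fun s p => by
        have := hS s⁻¹ (fun a => (p a).1) (fun a => (p a).2)
        rw [hact, hact, inv_inv] at this
        exact this) h0
    rw [Fintype.sum_sum_type] at h1
    simp only [Sum.elim_inl, Sum.elim_inr, neg_mul, Finset.sum_neg_distrib] at h1
    rw [add_neg_eq_zero] at h1
    rw [h1]
    exact Finset.sum_congr rfl fun I _ => mul_comm _ _
  choose c hc using hdens
  have hfin : (fun A : Fin k → Matrix (Fin n) (Fin n) ℂ => eval (fun v => A v.1 v.2.1 v.2.2) P) =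
      ∑ w, ∑ s : Equiv.Perm (Fin d), c w s • (fun A : Fin k → Matrix (Fin n) (Fin n) ℂ =>
        ∑ J : Fin d → Fin n, ∏ a, A (w a) (J (s⁻¹ a)) (J a)) := by
    funext A
    rw [hsum]
    simp only [Finset.sum_apply, Pi.smul_apply, smul_eq_mul]
    refine Finset.sum_congr rfl fun w _ => ?_
    rw [Finset.sum_comm]
    simp only [hc, Finset.sum_mul, Finset.mul_sum]
    conv_rhs => rw [Finset.sum_comm]
    refine Finset.sum_congr rfl fun J _ => ?_
    rw [Finset.sum_comm]
    refine Finset.sum_congr rfl fun s _ => ?_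
    simp only [mul_ite, mul_one, mul_zero, ite_mul, zero_mul, Finset.sum_ite_eq, Finset.mem_univ,
      if_true]
    rfl
  rw [hfin]
  exact Subalgebra.sum_mem _ fun w _ => Subalgebra.sum_mem _ fun s _ =>
    Subalgebra.smul_mem _ (trace_cycles n k d s⁻¹ w) _

lemma hard (n k : ℕ) (f : (Fin k → Matrix (Fin n) (Fin n) ℂ) → ℂ) (hf : f ∈ polyFns n k)
    (hi : IsConjInvariant n k f) :
    f ∈ Algebra.adjoin ℂ {f | ∃ w : List (Fin k), w ≠ [] ∧ f = traceFn n k w} := by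
  obtain ⟨P, hP⟩ := hf
  have hPe : ∀ A, f A = eval (fun v => A v.1 v.2.1 v.2.2) P := by
    intro A
    rw [← hP]
    have : ((Pi.evalAlgHom ℂ (fun _ : Fin k → Matrix (Fin n) (Fin n) ℂ => ℂ) A).comp
      (MvPolynomial.aeval (R := ℂ) (fun v : Fin k × Fin n × Fin n =>
        fun A : Fin k → Matrix (Fin n) (Fin n) ℂ => A v.1 v.2.1 v.2.2))) =
        aeval (fun v => A v.1 v.2.1 v.2.2) := by
      ext v
      simp
    have h2 := DFunLike.congr_fun this P
    rw [MvPolynomial.aeval_eq_eval] at h2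
    exact h2
  have hmain : ∀ d, (fun A : Fin k → Matrix (Fin n) (Fin n) ℂ =>
      eval (fun v => A v.1 v.2.1 v.2.2) (homogeneousComponent d P)) ∈
      Algebra.adjoin ℂ {f | ∃ w : List (Fin k), w ≠ [] ∧ f = traceFn n k w} := by
    intro d
    apply core n k d _ (homogeneousComponent_isHomogeneous d P)
    intro g A
    set G : Matrix (Fin n) (Fin n) ℂ := (g : Matrix (Fin n) (Fin n) ℂ) with hG
    let ψ1 : Fin k × Fin n × Fin n → MvPolynomial (Fin k × Fin n × Fin n) ℂ :=
      fun v => ∑ x, C (G v.2.1 x) * X (v.1, x, v.2.2)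
    let ψ2 : Fin k × Fin n × Fin n → MvPolynomial (Fin k × Fin n × Fin n) ℂ :=
      fun v => ∑ x, C (G x v.2.2) * X (v.1, v.2.1, x)
    have hψ1 : ∀ v, (ψ1 v).IsHomogeneous 1 := fun v =>
      IsHomogeneous.sum _ _ _ fun x _ => isHomogeneous_C_mul_X _ _
    have hψ2 : ∀ v, (ψ2 v).IsHomogeneous 1 := fun v =>
      IsHomogeneous.sum _ _ _ fun x _ => isHomogeneous_C_mul_X _ _
    have e1 : ∀ (B : Fin k × Fin n × Fin n → ℂ) Q, eval B (aeval ψ1 Q) =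
        eval (fun v => (G * (Matrix.of fun i j => B (v.1, i, j))) v.2.1 v.2.2) Q := by
      intro B Q
      rw [← MvPolynomial.aeval_eq_eval, ← MvPolynomial.aeval_eq_eval]
      change (aeval B) (aeval ψ1 Q) = _
      rw [← AlgHom.comp_apply, comp_aeval]
      congr 2
      funext v
      simp [ψ1, Matrix.mul_apply]
    have e2 : ∀ (B : Fin k × Fin n × Fin n → ℂ) Q, eval B (aeval ψ2 Q) =
        eval (fun v => ((Matrix.of fun i j => B (v.1, i, j)) * G) v.2.1 v.2.2) Q := by
      intro B Q
      rw [← MvPolynomial.aeval_eq_eval, ← MvPolynomial.aeval_eq_eval]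
      change (aeval B) (aeval ψ2 Q) = _
      rw [← AlgHom.comp_apply, comp_aeval]
      congr 2
      funext v
      simp [ψ2, Matrix.mul_apply, mul_comm]
    have h12 : aeval ψ1 P = aeval ψ2 P := by
      apply MvPolynomial.funext
      intro B
      rw [e1, e2]
      let B' : Fin k → Matrix (Fin n) (Fin n) ℂ := fun l => Matrix.of fun i j => B (l, i, j)
      have := hi g (fun l => B' l * G)
      rw [hPe, hPe] at this
      rw [← this]
      congr 2
      funext v
      have hg : G * ((g⁻¹ : GL (Fin n) ℂ) : Matrix (Fin n) (Fin n) ℂ) = 1 := by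
        rw [hG, ← Units.val_mul, mul_inv_cancel, Units.val_one]
      rw [← hG, mul_assoc, mul_assoc, hg, mul_one]
    have h3 := congrArg (homogeneousComponent d) h12
    rw [homComp_bind _ hψ1, homComp_bind _ hψ2] at h3
    have h4 := congrArg (eval (fun v => A v.1 v.2.1 v.2.2)) h3
    rw [e1, e2] at h4
    exact h4
  have : f = ∑ d ∈ Finset.range (P.totalDegree + 1),
      (fun A : Fin k → Matrix (Fin n) (Fin n) ℂ =>
      eval (fun v => A v.1 v.2.1 v.2.2) (homogeneousComponent d P)) := by
    funext A
    rw [hPe, Finset.sum_apply, ← map_sum, sum_homogeneousComponent]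
  rw [this]
  exact Subalgebra.sum_mem _ fun d _ => hmain d

lemma easy_poly (n k : ℕ) (w : List (Fin k)) : traceFn n k w ∈ polyFns n k := by
  have h : ∀ (w : List (Fin k)) i j,
      (fun A : Fin k → Matrix (Fin n) (Fin n) ℂ => (w.map A).prod i j) ∈ polyFns n k := by
    intro w
    induction w with
    | nil =>
      intro i j
      exact Subalgebra.algebraMap_mem (polyFns n k) ((1 : Matrix (Fin n) (Fin n) ℂ) i j)
    | cons l w ih =>
      intro i j
      have : (fun A : Fin k → Matrix (Fin n) (Fin n) ℂ => ((l :: w).map A).prod i j) =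
          ∑ x, (fun A : Fin k → Matrix (Fin n) (Fin n) ℂ => A l i x) *
            (fun A : Fin k → Matrix (Fin n) (Fin n) ℂ => (w.map A).prod x j) := by
        funext A
        simp [Matrix.mul_apply]
      rw [this]
      refine Subalgebra.sum_mem _ fun x _ => Subalgebra.mul_mem _ ?_ (ih x j)
      exact ⟨X (l, i, x), by simp⟩
  have : traceFn n k w = ∑ i, (fun A : Fin k → Matrix (Fin n) (Fin n) ℂ => (w.map A).prod i i) := by
    funext A
    simp [traceFn, Matrix.trace]
  rw [this]
  exact Subalgebra.sum_mem _ fun x _ => h w x x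

lemma easy_inv (n k : ℕ) (w : List (Fin k)) : IsConjInvariant n k (traceFn n k w) := by
  intro g A
  have h : ∀ w : List (Fin k), (w.map (fun i => (g : Matrix (Fin n) (Fin n) ℂ) * A i *
      ((g⁻¹ : GL (Fin n) ℂ) : Matrix (Fin n) (Fin n) ℂ))).prod =
      (g : Matrix (Fin n) (Fin n) ℂ) * (w.map A).prod *
      ((g⁻¹ : GL (Fin n) ℂ) : Matrix (Fin n) (Fin n) ℂ) := by
    intro w
    induction w with
    | nil => simp only [List.map_nil, List.prod_nil, mul_one, Units.mul_inv]
    | cons l w ih =>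
      rw [List.map_cons, List.prod_cons, ih, List.map_cons, List.prod_cons]
      simp only [mul_assoc, Units.inv_mul_cancel_left]
  unfold traceFn
  rw [h, Matrix.trace_mul_comm, ← mul_assoc, Units.inv_mul, one_mul]

end Helpers

/-- STATEMENT 9: the algebra of conjugation-invariant polynomial functions on `k`-tuples of
`n×n` matrices is generated by the trace functions of nonempty words. -/
theorem stmt_9 (n k : ℕ) (hn : 1 ≤ n) (hk : 1 ≤ k) :
    (Algebra.adjoin ℂ {f | ∃ w : List (Fin k), w ≠ [] ∧ f = traceFn n k w} :
        Set ((Fin k → Matrix (Fin n) (Fin n) ℂ) → ℂ))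
      = {f | f ∈ polyFns n k ∧ IsConjInvariant n k f} := by
  apply Set.Subset.antisymm
  · intro f hf
    refine Algebra.adjoin_induction
      (p := fun f _ => f ∈ polyFns n k ∧ IsConjInvariant n k f) ?_ ?_ ?_ ?_ hf
    · rintro f ⟨w, _, rfl⟩
      exact ⟨easy_poly n k w, easy_inv n k w⟩
    · intro r
      exact ⟨Subalgebra.algebraMap_mem _ r, fun g A => rfl⟩
    · rintro f g _ _ ⟨h1, h2⟩ ⟨h3, h4⟩
      exact ⟨Subalgebra.add_mem _ h1 h3, fun x A => congrArg₂ (· + ·) (h2 x A) (h4 x A)⟩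
    · rintro f g _ _ ⟨h1, h2⟩ ⟨h3, h4⟩
      exact ⟨Subalgebra.mul_mem _ h1 h3, fun x A => congrArg₂ (· * ·) (h2 x A) (h4 x A)⟩
  · rintro f ⟨h1, h2⟩
    exact hard n k f h1 h2
end
end
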